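/- Let Ω ⊂ ℝ² be a bounded open connected set with (0,0) ∈ Ω, and let u be a smooth function on an open set containing the closure of Ω such that -Δu = f(u) in Ω with f smooth and f(0) ≥ 0, u > 0 in Ω, u = 0 on ∂Ω, and (0,0) is the only critical point of u in Ω. Then the following alternative holds: either the Hessian matrix of u at (0,0) is invertible (i.e. (0,0) is nondegenerate), or for every c with 0 < c < u(0,0) there exists a point p with u(p) = c at which (u_xx u_y² - 2 u_xy u_x u_y + u_yy u_x²)(p) ≥ 0, i.e. every level set of u contains a point where its curvature is nonpositive. -/

import Mathlib

open Filter Metric Set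

/-- Partial derivative in the first variable. -/
noncomputable def pdx (u : ℝ → ℝ → ℝ) : ℝ → ℝ → ℝ := fun x y => deriv (fun t => u t y) x

/-- Partial derivative in the second variable. -/
noncomputable def pdy (u : ℝ → ℝ → ℝ) : ℝ → ℝ → ℝ := fun x y => deriv (fun t => u x t) y

/-- `pd u i j = ∂^(i+j) u / ∂x^i ∂y^j`. -/
noncomputable def pd (u : ℝ → ℝ → ℝ) (i j : ℕ) : ℝ → ℝ → ℝ := pdx^[i] (pdy^[j] u)

/-- The open unit ball of `ℝ²`. -/
def B1 : Set (ℝ × ℝ) := Metric.ball (0 : ℝ × ℝ) 1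

/-- Real part of `(x+iy)^n`. -/
noncomputable def ReZ (n : ℕ) (x y : ℝ) : ℝ := (((x : ℂ) + (y : ℂ) * Complex.I) ^ n).re

/-- Imaginary part of `(x+iy)^n`. -/
noncomputable def ImZ (n : ℕ) (x y : ℝ) : ℝ := (((x : ℂ) + (y : ℂ) * Complex.I) ^ n).im

/-- The numerator `u_xx u_y² - 2 u_xy u_x u_y + u_yy u_x²` whose negativity expresses
strictly positive curvature of the level curve of `u`. -/
noncomputable def curvNum (u : ℝ → ℝ → ℝ) (x y : ℝ) : ℝ :=
  pd u 2 0 x y * (pd u 0 1 x y) ^ 2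
    - 2 * pd u 1 1 x y * pd u 1 0 x y * pd u 0 1 x y
    + pd u 0 2 x y * (pd u 1 0 x y) ^ 2


/-- `F` is differentiable at `p` with gradient `(a, b)`. -/
def HasGrad (F : ℝ × ℝ → ℝ) (a b : ℝ) (p : ℝ × ℝ) : Prop :=
  HasFDerivAt F (a • ContinuousLinearMap.fst ℝ ℝ ℝ + b • ContinuousLinearMap.snd ℝ ℝ ℝ) p

namespace HasGrad

variable {F H : ℝ × ℝ → ℝ} {a b a' b' : ℝ} {p : ℝ × ℝ}

lemma congr (h : HasGrad F a b p) (ha : a = a') (hb : b = b') : HasGrad F a' b' p := by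
  subst ha; subst hb; exact h

lemma congrF (h : HasGrad F a b p) (hF : H =ᶠ[nhds p] F) : HasGrad H a b p :=
  HasFDerivAt.congr_of_eventuallyEq h hF

lemma add (h : HasGrad F a b p) (h' : HasGrad H a' b' p) :
    HasGrad (fun z => F z + H z) (a + a') (b + b') p := by
  have := HasFDerivAt.add h h'
  refine HasFDerivAt.congr_fderiv this ?_
  ext <;> simp

lemma neg (h : HasGrad F a b p) :
    HasGrad (fun z => - F z) (-a) (-b) p := by
  have := HasFDerivAt.neg h
  refine HasFDerivAt.congr_fderiv this ?_
  ext <;> simp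

lemma sub (h : HasGrad F a b p) (h' : HasGrad H a' b' p) :
    HasGrad (fun z => F z - H z) (a - a') (b - b') p := by
  have := HasFDerivAt.sub h h'
  refine HasFDerivAt.congr_fderiv this ?_
  ext <;> simp

lemma mul (h : HasGrad F a b p) (h' : HasGrad H a' b' p) :
    HasGrad (fun z => F z * H z) (a * H p + F p * a') (b * H p + F p * b') p := by
  have := HasFDerivAt.mul h h'
  refine HasFDerivAt.congr_fderiv this ?_
  ext <;> simp <;> ring

lemma const (c : ℝ) : HasGrad (fun _ => c) 0 0 p := by
  have := hasFDerivAt_const (𝕜 := ℝ) c p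
  refine HasFDerivAt.congr_fderiv this ?_
  ext <;> simp

lemma fst : HasGrad (fun z => z.1) 1 0 p := by
  have := hasFDerivAt_fst (𝕜 := ℝ) (p := p)
  refine HasFDerivAt.congr_fderiv this ?_
  ext <;> simp

lemma snd : HasGrad (fun z => z.2) 0 1 p := by
  have := hasFDerivAt_snd (𝕜 := ℝ) (p := p)
  refine HasFDerivAt.congr_fderiv this ?_
  ext <;> simp

lemma comp1 {g : ℝ → ℝ} {g' : ℝ} (hg : HasDerivAt g g' (F p)) (h : HasGrad F a b p) :
    HasGrad (fun z => g (F z)) (g' * a) (g' * b) p := by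
  have := HasDerivAt.comp_hasFDerivAt p hg h
  refine HasFDerivAt.congr_fderiv this ?_
  ext <;> simp

lemma const_mul (c : ℝ) (h : HasGrad F a b p) :
    HasGrad (fun z => c * F z) (c * a) (c * b) p :=
  (HasGrad.mul (HasGrad.const c) h).congr (by ring) (by ring)

lemma continuousAt (h : HasGrad F a b p) : ContinuousAt F p :=
  HasFDerivAt.continuousAt h

/-- derivative along a line -/
lemma line (q v : ℝ × ℝ) (t : ℝ) (h : HasGrad F a b (q + t • v)) :
    HasDerivAt (fun s : ℝ => F (q + s • v)) (a * v.1 + b * v.2) t := by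
  have h1 : HasDerivAt (fun s : ℝ => q + s • v) v t := by
    have := ((hasDerivAt_id t).smul_const v).const_add q
    simpa using this
  have := HasFDerivAt.comp_hasDerivAt (f := fun s : ℝ => q + s • v) t h h1
  refine HasDerivAt.congr_deriv this ?_
  simp

lemma bigO (h : HasGrad F a b p) :
    ∃ C, 0 ≤ C ∧ ∀ᶠ z in nhds p, |F z - F p| ≤ C * ‖z - p‖ := by
  have := HasFDerivAt.isBigO_sub h
  obtain ⟨C, hC, hh⟩ := this.exists_nonneg
  refine ⟨C, hC, ?_⟩
  have := hh.bound
  simpa using this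

/-- composition with a rotation -/
lemma rot (α β : ℝ) (h : HasGrad F a b (α * p.1 - β * p.2, β * p.1 + α * p.2)) :
    HasGrad (fun z => F (α * z.1 - β * z.2, β * z.1 + α * z.2))
      (α * a + β * b) (-β * a + α * b) p := by
  have h1 : HasFDerivAt (fun z : ℝ × ℝ => (α * z.1 - β * z.2, β * z.1 + α * z.2))
    (((α • ContinuousLinearMap.fst ℝ ℝ ℝ + (-β) • ContinuousLinearMap.snd ℝ ℝ ℝ)).prod
      (β • ContinuousLinearMap.fst ℝ ℝ ℝ + α • ContinuousLinearMap.snd ℝ ℝ ℝ)) p := by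
    apply HasFDerivAt.prodMk
    · exact ((HasGrad.fst.const_mul α).sub (HasGrad.snd.const_mul β)).congr (by ring) (by ring)
    · exact ((HasGrad.fst.const_mul β).add (HasGrad.snd.const_mul α)).congr (by ring) (by ring)
  have := HasFDerivAt.comp p (f := fun z : ℝ × ℝ => (α * z.1 - β * z.2, β * z.1 + α * z.2)) h h1
  refine HasFDerivAt.congr_fderiv this ?_
  ext <;> simp <;> ring

end HasGrad

/-- One variable second order necessary condition at a local maximum. -/
lemma second_order_max (g g' : ℝ → ℝ) (g2 : ℝ)
    (h : ∀ᶠ t in nhds (0 : ℝ), HasDerivAt g (g' t) t) (h2 : HasDerivAt g' g2 0)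
    (hmax : IsLocalMax g 0) : g' 0 = 0 ∧ g2 ≤ 0 := by
  have h0 : g' 0 = 0 := hmax.hasDerivAt_eq_zero h.self_of_nhds
  refine ⟨h0, ?_⟩
  by_contra hc
  push Not at hc
  have hd : deriv g =ᶠ[nhds 0] g' := h.mono fun t ht => ht.deriv
  have e1 : deriv (deriv g) 0 = g2 := by rw [hd.deriv_eq]; exact h2.deriv
  have hmin : IsLocalMin g 0 :=
    isLocalMin_of_deriv_deriv_pos (by rw [e1]; exact hc) (by rw [hd.self_of_nhds]; exact h0)
      h.self_of_nhds.continuousAt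
  have hconst : g =ᶠ[nhds 0] fun _ => g 0 := by
    filter_upwards [hmin, hmax] with t h1 h2 using le_antisymm h2 h1
  have : deriv g =ᶠ[nhds 0] fun _ => 0 := by
    have := hconst.deriv
    simpa using this
  have e2 := this.deriv_eq
  rw [e1] at e2
  simp at e2
  linarith

/-- Two variable second order necessary condition at a local maximum. -/
lemma second_order_max2 (g gx gy : ℝ × ℝ → ℝ) (p : ℝ × ℝ) (α β γ δ : ℝ)
    (h : ∀ᶠ z in nhds p, HasGrad g (gx z) (gy z) z)
    (hx : HasGrad gx α β p) (hy : HasGrad gy γ δ p) (hmax : IsLocalMax g p) :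
    gx p = 0 ∧ gy p = 0 ∧ α ≤ 0 ∧ δ ≤ 0 := by
  have key : ∀ v : ℝ × ℝ, Tendsto (fun s : ℝ => p + s • v) (nhds 0) (nhds p) := by
    intro v
    have : Continuous (fun s : ℝ => p + s • v) := by fun_prop
    simpa using this.tendsto 0
  have A := second_order_max (fun s => g (p + s • ((1, 0) : ℝ × ℝ)))
    (fun s => gx (p + s • ((1, 0) : ℝ × ℝ))) α
    (by
      filter_upwards [(key (1, 0)).eventually h] with t ht
      simpa using HasGrad.line p (1, 0) t ht)
    (by
      have := HasGrad.line p (1, 0) 0 (F := gx) (a := α) (b := β) (by simpa using hx)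
      simpa using this)
    (by
      have := (key (1, 0)).eventually hmax
      unfold IsLocalMax IsMaxFilter
      simpa using this)
  have B := second_order_max (fun s => g (p + s • ((0, 1) : ℝ × ℝ)))
    (fun s => gy (p + s • ((0, 1) : ℝ × ℝ))) δ
    (by
      filter_upwards [(key (0, 1)).eventually h] with t ht
      simpa using HasGrad.line p (0, 1) t ht)
    (by
      have := HasGrad.line p (0, 1) 0 (F := gy) (a := γ) (b := δ) (by simpa using hy)
      simpa using this)
    (by
      have := (key (0, 1)).eventually hmax
      unfold IsLocalMax IsMaxFilter
      simpa using this)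
  simp at A B
  exact ⟨A.1, B.1, A.2, B.2⟩

/-- Touching principle. -/
lemma touch (P Px Py η ηx ηy : ℝ × ℝ → ℝ) (p : ℝ × ℝ) (Pxx Pxy Pyx Pyy ηxx ηxy ηyx ηyy : ℝ)
    (r2 bx bY δ : ℝ) (hδ : 0 < δ) (hr : 0 ≤ r2)
    (hP : ∀ᶠ z in nhds p, HasGrad P (Px z) (Py z) z)
    (hPx : HasGrad Px Pxx Pxy p) (hPy : HasGrad Py Pyx Pyy p)
    (hη : ∀ᶠ z in nhds p, HasGrad η (ηx z) (ηy z) z)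
    (hηx : HasGrad ηx ηxx ηxy p) (hηy : HasGrad ηy ηyx ηyy p)
    (heq : r2 * (Pxx + Pyy) = bx * Px p + bY * Py p)
    (hsub : 0 < r2 * (ηxx + ηyy) - (bx * ηx p + bY * ηy p))
    (hmax : IsLocalMax (fun z => P z + δ * η z) p) : False := by
  obtain ⟨h1, h2, h3, h4⟩ := second_order_max2 (fun z => P z + δ * η z)
    (fun z => Px z + δ * ηx z) (fun z => Py z + δ * ηy z) p _ _ _ _
    (by filter_upwards [hP, hη] with z h1 h2 using h1.add (h2.const_mul δ))
    (hPx.add (hηx.const_mul δ)) (hPy.add (hηy.const_mul δ)) hmax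
  have e1 : Px p = - (δ * ηx p) := by linarith
  have e2 : Py p = - (δ * ηy p) := by linarith
  rw [e1, e2] at heq
  have : r2 * ((Pxx + δ * ηxx) + (Pyy + δ * ηyy)) ≤ 0 :=
    mul_nonpos_of_nonneg_of_nonpos hr (by linarith)
  have h5 : 0 < δ * (r2 * (ηxx + ηyy) - (bx * ηx p + bY * ηy p)) := mul_pos hδ hsub
  nlinarith

/-- A function together with its partial derivatives up to third order on an open set `W`. -/
structure Dat (W : Set (ℝ × ℝ)) (U ux uy uxx uxy uyy uxxx uxxy uxyy uyyy : ℝ × ℝ → ℝ) : Prop where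
  opn : IsOpen W
  hU : ∀ p ∈ W, HasGrad U (ux p) (uy p) p
  hux : ∀ p ∈ W, HasGrad ux (uxx p) (uxy p) p
  huy : ∀ p ∈ W, HasGrad uy (uxy p) (uyy p) p
  huxx : ∀ p ∈ W, HasGrad uxx (uxxx p) (uxxy p) p
  huxy : ∀ p ∈ W, HasGrad uxy (uxxy p) (uxyy p) p
  huyy : ∀ p ∈ W, HasGrad uyy (uxyy p) (uyyy p) p

section core

variable {W : Set (ℝ × ℝ)} {U ux uy uxx uxy uyy uxxx uxxy uxyy uyyy : ℝ × ℝ → ℝ}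
  {f G : ℝ → ℝ}

/-- The gradient of the P-function. -/
lemma gradP (D : Dat W U ux uy uxx uxy uyy uxxx uxxy uxyy uyyy)
    (hG : ∀ s, HasDerivAt G (f s) s)
    (hpde : ∀ p ∈ W, -(uxx p + uyy p) = f (U p)) (p : ℝ × ℝ) (hp : p ∈ W) :
    HasGrad (fun z => (ux z * ux z + uy z * uy z) * (1 / 2) + G (U z))
      (uy p * uxy p - ux p * uyy p) (ux p * uxy p - uy p * uxx p) p := by
  have h := ((((D.hux p hp).mul (D.hux p hp)).add ((D.huy p hp).mul (D.huy p hp))).mul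
    (HasGrad.const (1 / 2))).add ((D.hU p hp).comp1 (hG (U p)))
  refine h.congr ?_ ?_
  · rw [← hpde p hp]; ring
  · rw [← hpde p hp]; ring

/-- Interior touching for the P-function. -/
lemma touchP (D : Dat W U ux uy uxx uxy uyy uxxx uxxy uxyy uyyy)
    (hG : ∀ s, HasDerivAt G (f s) s)
    (hpde : ∀ p ∈ W, -(uxx p + uyy p) = f (U p)) (p : ℝ × ℝ) (hp : p ∈ W)
    (η ηx ηy : ℝ × ℝ → ℝ) (ηxx ηxy ηyx ηyy δ : ℝ) (hδ : 0 < δ)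
    (hη : ∀ᶠ z in nhds p, HasGrad η (ηx z) (ηy z) z)
    (hηx : HasGrad ηx ηxx ηxy p) (hηy : HasGrad ηy ηyx ηyy p)
    (hsub : 0 < (ux p * ux p + uy p * uy p) * (ηxx + ηyy) -
      (2 * (ux p * uxx p + uy p * uxy p) * ηx p + 2 * (ux p * uxy p + uy p * uyy p) * ηy p))
    (hmax : IsLocalMax (fun z => (ux z * ux z + uy z * uy z) * (1 / 2) + G (U z) + δ * η z) p) :
    False := by
  refine touch (fun z => (ux z * ux z + uy z * uy z) * (1 / 2) + G (U z))
    (fun p => uy p * uxy p - ux p * uyy p) (fun p => ux p * uxy p - uy p * uxx p)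
    η ηx ηy p _ _ _ _ _ _ _ _ _ _ _ δ hδ ?_ ?_
    (((D.huy p hp).mul (D.huxy p hp)).sub ((D.hux p hp).mul (D.huyy p hp)))
    (((D.hux p hp).mul (D.huxy p hp)).sub ((D.huy p hp).mul (D.huxx p hp)))
    hη hηx hηy ?_ hsub hmax
  · exact add_nonneg (mul_self_nonneg _) (mul_self_nonneg _)
  · filter_upwards [D.opn.mem_nhds hp] with z hz using gradP D hG hpde z hz
  · ring

/-- Strong maximum principle step. -/
lemma smp (D : Dat W U ux uy uxx uxy uyy uxxx uxxy uxyy uyyy)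
    (hG : ∀ s, HasDerivAt G (f s) s)
    (hpde : ∀ p ∈ W, -(uxx p + uyy p) = f (U p)) (q : ℝ × ℝ) (hq : q ∈ W)
    (hr : 0 < ux q * ux q + uy q * uy q) (P : ℝ × ℝ → ℝ)
    (hP : P = fun z => (ux z * ux z + uy z * uy z) * (1 / 2) + G (U z))
    (h1 : ∀ᶠ p in nhds q, P p ≤ P q) (h2 : ∀ᶠ p in nhds q, U p < U q → P p < P q) : False := by
  have hcP : ∀ p ∈ W, ContinuousAt P p := by
    intro p hp; rw [hP]; exact (gradP D hG hpde p hp).continuousAt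
  set d : ℝ × ℝ → ℝ := fun p => U q - U p - ((p.1 - q.1) * (p.1 - q.1) + (p.2 - q.2) * (p.2 - q.2))
    with hd
  set dx : ℝ × ℝ → ℝ := fun p => - ux p - 2 * (p.1 - q.1) with hdx
  set dy : ℝ × ℝ → ℝ := fun p => - uy p - 2 * (p.2 - q.2) with hdy
  have hdg : ∀ p ∈ W, HasGrad d (dx p) (dy p) p := by
    intro p hp
    have a1 : HasGrad (fun z : ℝ × ℝ => z.1 - q.1) 1 0 p :=
      (HasGrad.fst.sub (HasGrad.const q.1)).congr (by ring) (by ring)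
    have a2 : HasGrad (fun z : ℝ × ℝ => z.2 - q.2) 0 1 p :=
      (HasGrad.snd.sub (HasGrad.const q.2)).congr (by ring) (by ring)
    exact (((HasGrad.const (U q)).sub (D.hU p hp)).sub ((a1.mul a1).add (a2.mul a2))).congr
      (by simp [hdx]; ring) (by simp [hdy]; ring)
  have hdxg : ∀ p ∈ W, HasGrad dx (- uxx p - 2) (- uxy p) p := by
    intro p hp
    exact ((D.hux p hp).neg.sub ((HasGrad.fst.sub (HasGrad.const q.1)).const_mul 2)).congr
      (by ring) (by ring)
  have hdyg : ∀ p ∈ W, HasGrad dy (- uxy p) (- uyy p - 2) p := by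
    intro p hp
    exact ((D.huy p hp).neg.sub ((HasGrad.snd.sub (HasGrad.const q.2)).const_mul 2)).congr
      (by ring) (by ring)
  -- the bracket
  set r2 : ℝ × ℝ → ℝ := fun p => ux p * ux p + uy p * uy p with hr2
  set E0 : ℝ × ℝ → ℝ := fun p => r2 p * ((- uxx p - 2) + (- uyy p - 2)) -
    (2 * (ux p * uxx p + uy p * uxy p) * dx p + 2 * (ux p * uxy p + uy p * uyy p) * dy p) with hE0
  obtain ⟨a, ha0, ha⟩ : ∃ a : ℝ, 0 < a ∧ 0 < a * (r2 q * r2 q) + E0 q := by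
    have hpos : 0 < r2 q * r2 q := mul_pos hr hr
    refine ⟨(|E0 q| + 1) / (r2 q * r2 q), by positivity, ?_⟩
    rw [div_mul_cancel₀ _ hpos.ne']
    have := neg_abs_le (E0 q)
    linarith
  have hc1 := fun p hp => (D.hux p hp).continuousAt
  have hc2 := fun p hp => (D.huy p hp).continuousAt
  have hc3 := fun p hp => (D.huxx p hp).continuousAt
  have hc4 := fun p hp => (D.huxy p hp).continuousAt
  have hc5 := fun p hp => (D.huyy p hp).continuousAt
  have hc6 := fun p hp => (hdxg p hp).continuousAt
  have hc7 := fun p hp => (hdyg p hp).continuousAt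
  have hEc : ContinuousAt (fun p => a * (r2 p * (dx p * dx p + dy p * dy p)) + E0 p) q := by
    have := hc1 q hq
    have := hc2 q hq
    have := hc3 q hq
    have := hc4 q hq
    have := hc5 q hq
    have := hc6 q hq
    have := hc7 q hq
    simp only [hE0, hr2]
    fun_prop
  have hEpos : ∀ᶠ p in nhds q, 0 < a * (r2 p * (dx p * dx p + dy p * dy p)) + E0 p := by
    apply hEc.eventually_const_lt (u := 0)
    have e1 : dx q = - ux q := by simp [hdx]
    have e2 : dy q = - uy q := by simp [hdy]
    have e3 : dx q * dx q + dy q * dy q = r2 q := by rw [e1, e2, hr2]; ring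
    show 0 < a * (r2 q * (dx q * dx q + dy q * dy q)) + E0 q
    rw [e3]; exact ha
  obtain ⟨ε, hε, hball⟩ := Metric.nhds_basis_closedBall.eventually_iff.1
    (h1.and (h2.and (hEpos.and (D.opn.mem_nhds hq))))
  set η : ℝ × ℝ → ℝ := fun p => Real.exp (a * d p) with hη
  have hW : ∀ p ∈ closedBall q ε, p ∈ W := fun p hp => (hball hp).2.2.2
  have hcη : ContinuousOn η (closedBall q ε) := by
    intro p hp
    have := (hdg p (hW p hp)).continuousAt
    apply ContinuousAt.continuousWithinAt
    simp only [hη]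
    fun_prop
  have hcd : ContinuousOn d (closedBall q ε) := fun p hp =>
    (hdg p (hW p hp)).continuousAt.continuousWithinAt
  have hcPo : ContinuousOn P (closedBall q ε) := fun p hp =>
    (hcP p (hW p hp)).continuousWithinAt
  have hK : IsCompact (closedBall q ε) := isCompact_closedBall q ε
  obtain ⟨B, hB⟩ := hK.exists_bound_of_continuousOn hcη
  have hB0 : 0 ≤ B := (norm_nonneg _).trans (hB q (mem_closedBall_self hε.le))
  have hS : IsCompact (sphere q ε ∩ {p | 0 ≤ d p}) := by
    have : IsClosed (sphere q ε ∩ d ⁻¹' (Ici 0)) :=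
      (hcd.mono sphere_subset_closedBall).preimage_isClosed_of_isClosed isClosed_sphere isClosed_Ici
    exact (isCompact_sphere q ε).of_isClosed_subset this inter_subset_left
  have hlt : ∀ p ∈ sphere q ε ∩ {p | 0 ≤ d p}, P p < P q := by
    rintro p ⟨hps, hpd⟩
    apply (hball (sphere_subset_closedBall hps)).2.1
    have hne : p ≠ q := by
      rintro rfl
      simp at hps
      linarith
    have : 0 < (p.1 - q.1) * (p.1 - q.1) + (p.2 - q.2) * (p.2 - q.2) := by
      by_contra hcon
      push Not at hcon
      apply hne
      have i1 := mul_self_nonneg (p.1 - q.1)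
      have i2 := mul_self_nonneg (p.2 - q.2)
      have j1 : p.1 - q.1 = 0 := mul_self_eq_zero.1 (by linarith)
      have j2 : p.2 - q.2 = 0 := mul_self_eq_zero.1 (by linarith)
      exact Prod.ext (by linarith) (by linarith)
    simp only [mem_ofPred_eq, hd] at hpd
    linarith
  obtain ⟨m, hm, hmS⟩ : ∃ m > 0, ∀ p ∈ sphere q ε ∩ {p | 0 ≤ d p}, P p ≤ P q - m := by
    rcases (sphere q ε ∩ {p | 0 ≤ d p}).eq_empty_or_nonempty with h | h
    · exact ⟨1, one_pos, by rw [h]; simp⟩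
    · obtain ⟨z, hz, hzm⟩ := hS.exists_isMaxOn h
        (hcPo.mono (inter_subset_left.trans sphere_subset_closedBall))
      refine ⟨P q - P z, by linarith [hlt z hz], fun p hp => ?_⟩
      have := hzm hp
      simp only [mem_ofPred_eq] at this
      linarith
  set δ := m / (B + 1) with hδ
  have hδ0 : 0 < δ := by positivity
  have hδB : δ * B < m := by
    rw [hδ, div_mul_eq_mul_div, div_lt_iff₀ (by positivity)]
    nlinarith
  obtain ⟨p, hp, hpm⟩ := hK.exists_isMaxOn ⟨q, mem_closedBall_self hε.le⟩
    (hcPo.add (hcη.const_mul δ) (f := P) (g := fun z => δ * η z))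
  have hqv : P q + δ ≤ P p + δ * η p := by
    have := hpm (mem_closedBall_self hε.le)
    have e : η q = 1 := by simp [hη, hd]
    simp only [mem_ofPred_eq, Pi.add_apply] at this
    rw [e] at this
    linarith
  have hpb : p ∈ ball q ε := by
    by_contra hcon
    have hps : p ∈ sphere q ε := by
      simp only [mem_ball, mem_closedBall, mem_sphere] at *
      linarith
    by_cases hdp : 0 ≤ d p
    · have i1 := hmS p ⟨hps, hdp⟩
      have i2 : η p ≤ B := (le_abs_self _).trans (hB p hp)
      nlinarith
    · have i1 : η p < 1 := by
        simp only [hη]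
        rw [Real.exp_lt_one_iff]
        push Not at hdp
        exact mul_neg_of_pos_of_neg ha0 hdp
      have i2 := (hball hp).1
      nlinarith
  have hpW := hW p hp
  have hex : ∀ z ∈ W, HasGrad η (η z * (a * dx z)) (η z * (a * dy z)) z := by
    intro z hz
    exact HasGrad.comp1 (Real.hasDerivAt_exp (a * d z)) ((hdg z hz).const_mul a)
  refine touchP D hG hpde p hpW η _ _ _ _ _ _ δ hδ0
    (by filter_upwards [D.opn.mem_nhds hpW] with z hz using hex z hz)
    ((hex p hpW).mul ((hdxg p hpW).const_mul a)) ((hex p hpW).mul ((hdyg p hpW).const_mul a)) ?_ ?_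
  · have e := (hball hp).2.2.1
    have e2 : 0 < a * η p * (a * (r2 p * (dx p * dx p + dy p * dy p)) + E0 p) :=
      mul_pos (mul_pos ha0 (Real.exp_pos _)) e
    simp only [hE0, hr2] at e2
    refine e2.trans_eq ?_
    ring
  · have : IsLocalMax (P + fun z => δ * η z) p :=
      hpm.isLocalMax (Filter.mem_of_superset (isOpen_ball.mem_nhds hpb) ball_subset_closedBall)
    rw [hP] at this
    exact this

end core

section core

variable {W : Set (ℝ × ℝ)} {U ux uy uxx uxy uyy uxxx uxxy uxyy uyyy : ℝ × ℝ → ℝ}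
  {f G : ℝ → ℝ}

lemma strictP (D : Dat W U ux uy uxx uxy uyy uxxx uxxy uxyy uyyy)
    (hG : ∀ s, HasDerivAt G (f s) s)
    (hpde : ∀ p ∈ W, -(uxx p + uyy p) = f (U p)) (P : ℝ × ℝ → ℝ)
    (hP : P = fun z => (ux z * ux z + uy z * uy z) * (1 / 2) + G (U z))
    (h0 : (0 : ℝ × ℝ) ∈ W)
    (huniq : ∀ p ∈ W, ux p = 0 → uy p = 0 → p = 0) (c : ℝ) (hc : c < U 0)
    (hcomp : IsCompact {p | p ∈ W ∧ c ≤ U p})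
    (hcurv : ∀ p ∈ W, U p = c →
      uxx p * uy p ^ 2 - 2 * uxy p * ux p * uy p + uyy p * ux p ^ 2 < 0) :
    (∀ᶠ p in nhds (0 : ℝ × ℝ), p ≠ 0 → U p < U 0) ∧
      (∀ᶠ p in nhds (0 : ℝ × ℝ), p ≠ 0 → P p < P 0) := by
  set K : Set (ℝ × ℝ) := {p | p ∈ W ∧ c ≤ U p} with hK
  have hcU : ContinuousOn U K := fun p hp => (D.hU p hp.1).continuousAt.continuousWithinAt
  have hgP : ∀ p ∈ W, HasGrad P (uy p * uxy p - ux p * uyy p) (ux p * uxy p - uy p * uxx p) p := by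
    intro p hp; rw [hP]; exact gradP D hG hpde p hp
  have hcP : ContinuousOn P K := fun p hp => (hgP p hp.1).continuousAt.continuousWithinAt
  have h0K : (0 : ℝ × ℝ) ∈ K := ⟨h0, hc.le⟩
  have hnhds : ∀ p ∈ W, c < U p → K ∈ nhds p := by
    intro p hp hcp
    filter_upwards [D.opn.mem_nhds hp, (D.hU p hp).continuousAt.eventually_const_lt hcp] with z h1 h2
    exact ⟨h1, h2.le⟩
  -- any maximum point of `U` over `K` is the origin
  have hmaxU : ∀ m ∈ K, IsMaxOn U K m → m = 0 := by
    intro m hm hmm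
    have hUm : U 0 ≤ U m := hmm h0K
    have hloc : IsLocalMax U m := hmm.isLocalMax (hnhds m hm.1 (hc.trans_le hUm))
    have hz := hloc.hasFDerivAt_eq_zero (D.hU m hm.1)
    have e1 := congrArg (fun T : (ℝ × ℝ) →L[ℝ] ℝ => T (1, 0)) hz
    have e2 := congrArg (fun T : (ℝ × ℝ) →L[ℝ] ℝ => T (0, 1)) hz
    simp at e1 e2
    exact huniq m hm.1 e1 e2
  obtain ⟨m, hm, hmm⟩ := hcomp.exists_isMaxOn ⟨0, h0K⟩ hcU
  have hm0 := hmaxU m hm hmm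
  rw [hm0] at hmm
  have hstrU : ∀ p ∈ K, p ≠ 0 → U p < U 0 := by
    intro p hp hne
    have hle : U p ≤ U 0 := hmm hp
    rcases hle.lt_or_eq with h | h
    · exact h
    · exfalso
      apply hne
      apply hmaxU p hp
      intro z hz
      have : U z ≤ U 0 := hmm hz
      simp only [mem_ofPred_eq]
      linarith
  -- maximum points of `P`
  obtain ⟨q0, hq0, hq0m⟩ := hcomp.exists_isMaxOn ⟨0, h0K⟩ hcP
  have hq0m' : ∀ p ∈ K, P p ≤ P q0 := fun p hp => hq0m hp
  set Z : Set (ℝ × ℝ) := K ∩ P ⁻¹' {P q0} with hZ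
  have hZc : IsCompact Z :=
    hcomp.of_isClosed_subset (hcP.preimage_isClosed_of_isClosed hcomp.isClosed isClosed_singleton)
      inter_subset_left
  obtain ⟨q, hq, hqm⟩ := hZc.exists_isMinOn ⟨q0, hq0, rfl⟩ (hcU.mono inter_subset_left)
  have hqm' : ∀ p ∈ Z, U q ≤ U p := fun p hp => hqm hp
  have hqP : P q = P q0 := hq.2
  have hqK : q ∈ K := hq.1
  -- the level `c` is excluded
  have hqc : c < U q := by
    rcases hqK.2.lt_or_eq with h | h
    · exact h
    exfalso
    have hne : q ≠ 0 := by rintro rfl; linarith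
    have hrpos : 0 < ux q * ux q + uy q * uy q := by
      by_contra hcon
      push Not at hcon
      have i1 := mul_self_nonneg (ux q)
      have i2 := mul_self_nonneg (uy q)
      exact hne (huniq q hqK.1 (mul_self_eq_zero.1 (by linarith)) (mul_self_eq_zero.1 (by linarith)))
    set v : ℝ × ℝ := (ux q, uy q) with hv
    have hline : Tendsto (fun s : ℝ => q + s • v) (nhds 0) (nhds q) := by
      have : Continuous (fun s : ℝ => q + s • v) := by fun_prop
      simpa using this.tendsto 0
    have d1 := HasGrad.line q v 0 (F := U) (a := ux q) (b := uy q)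
      (by simpa using D.hU q hqK.1)
    have d2 := HasGrad.line q v 0 (F := P) (a := uy q * uxy q - ux q * uyy q)
      (b := ux q * uxy q - uy q * uxx q) (by simpa using hgP q hqK.1)
    have p1 : 0 < ux q * v.1 + uy q * v.2 := hrpos
    have p2 : 0 < (uy q * uxy q - ux q * uyy q) * v.1 + (ux q * uxy q - uy q * uxx q) * v.2 := by
      have := hcurv q hqK.1 h.symm
      simp only [hv]
      nlinarith
    have pos_right : ∀ (g : ℝ → ℝ) (g' : ℝ), HasDerivAt g g' 0 → 0 < g' →
        ∀ᶠ t in nhdsWithin (0 : ℝ) (Ioi 0), g 0 < g t := by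
      intro g g' hg hg'
      have h1 := (hasDerivAt_iff_tendsto_slope.1 hg).mono_left
        (nhdsWithin_mono (0 : ℝ) (fun x (hx : x ∈ Ioi (0 : ℝ)) => (ne_of_gt hx : x ≠ 0)))
      filter_upwards [h1.eventually_const_lt hg', self_mem_nhdsWithin] with t ht ht0
      rw [slope_def_field] at ht
      have ht0' : (0 : ℝ) < t := ht0
      have := (div_pos_iff_of_pos_right (by linarith : (0 : ℝ) < t - 0)).1 ht
      linarith
    have ev1 := pos_right _ _ d1 p1
    have ev2 := pos_right _ _ d2 p2
    have ev3 : ∀ᶠ t in nhdsWithin (0 : ℝ) (Ioi 0), q + t • v ∈ W :=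
      (hline.eventually (D.opn.mem_nhds hqK.1)).filter_mono nhdsWithin_le_nhds
    obtain ⟨t, ⟨h1, h2⟩, h3⟩ := ((ev1.and ev2).and ev3).exists
    simp only [zero_smul, add_zero] at h1 h2
    have := hq0m' (q + t • v) ⟨h3, by linarith⟩
    linarith
  have hq00 : q = 0 := by
    by_contra hne
    have hrpos : 0 < ux q * ux q + uy q * uy q := by
      by_contra hcon
      push Not at hcon
      have i1 := mul_self_nonneg (ux q)
      have i2 := mul_self_nonneg (uy q)
      exact hne (huniq q hqK.1 (mul_self_eq_zero.1 (by linarith)) (mul_self_eq_zero.1 (by linarith)))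
    refine smp D hG hpde q hqK.1 hrpos P hP ?_ ?_
    · filter_upwards [hnhds q hqK.1 hqc] with p hp
      rw [hqP]; exact hq0m' p hp
    · filter_upwards [hnhds q hqK.1 hqc] with p hp hlt
      rw [hqP]
      rcases (hq0m' p hp).lt_or_eq with h | h
      · exact h
      · have := hqm' p ⟨hp, h⟩
        linarith
  subst hq00
  refine ⟨?_, ?_⟩
  · filter_upwards [hnhds 0 h0 hc] with p hp hne using hstrU p hp hne
  · filter_upwards [hnhds 0 h0 hc] with p hp hne
    rw [hqP]
    rcases (hq0m' p hp).lt_or_eq with h | h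
    · exact h
    · have := hqm' p ⟨hp, h⟩
      have := hstrU p hp hne
      linarith

/-- Integration of a power bound, one variable. -/
lemma pow_bound1 (g g' : ℝ → ℝ) (t0 C : ℝ) (hC : 0 ≤ C) (k : ℕ)
    (h : ∀ᶠ t in nhds t0, HasDerivAt g (g' t) t) (hb : ∀ᶠ t in nhds t0, |g' t| ≤ C * |t - t0| ^ k) :
    ∀ᶠ t in nhds t0, |g t - g t0| ≤ C * |t - t0| ^ (k + 1) := by
  obtain ⟨ε, hε, hball⟩ := Metric.nhds_basis_ball.eventually_iff.1 (h.and hb)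
  filter_upwards [ball_mem_nhds t0 hε] with t ht
  have hsub : closedBall t0 |t - t0| ⊆ ball t0 ε := by
    apply closedBall_subset_ball
    simpa [Real.dist_eq] using ht
  have := (convex_closedBall t0 |t - t0|).norm_image_sub_le_of_norm_hasDerivWithin_le
    (f := g) (f' := g') (C := C * |t - t0| ^ k)
    (fun x hx => (hball (hsub hx)).1.hasDerivWithinAt)
    (fun x hx => (hball (hsub hx)).2.trans (by
      have : |x - t0| ≤ |t - t0| := by simpa [Real.dist_eq] using hx
      gcongr))
    (x := t0) (y := t) (by simp) (by simp [Real.dist_eq])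
  rw [pow_succ, ← mul_assoc]
  simpa using this

/-- Integration of a power bound, two variables. -/
lemma pow_bound2 (F Fx Fy : ℝ × ℝ → ℝ) (C : ℝ) (hC : 0 ≤ C) (k : ℕ)
    (h : ∀ᶠ z in nhds (0 : ℝ × ℝ), HasGrad F (Fx z) (Fy z) z)
    (hx : ∀ᶠ z in nhds (0 : ℝ × ℝ), |Fx z| ≤ C * ‖z‖ ^ k)
    (hy : ∀ᶠ z in nhds (0 : ℝ × ℝ), |Fy z| ≤ C * ‖z‖ ^ k) :
    ∀ᶠ z in nhds (0 : ℝ × ℝ), |F z - F 0| ≤ 2 * C * ‖z‖ ^ (k + 1) := by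
  obtain ⟨ε, hε, hball⟩ := Metric.nhds_basis_ball.eventually_iff.1 (h.and (hx.and hy))
  filter_upwards [ball_mem_nhds (0 : ℝ × ℝ) hε] with z hz
  have hz' : ‖z‖ < ε := by simpa using hz
  have hsub : ∀ t ∈ Icc (0 : ℝ) 1, (0 : ℝ × ℝ) + t • z ∈ ball (0 : ℝ × ℝ) ε ∧
      ‖(0 : ℝ × ℝ) + t • z‖ ≤ ‖z‖ := by
    intro t ht
    have : ‖(0 : ℝ × ℝ) + t • z‖ ≤ ‖z‖ := by
      rw [zero_add, norm_smul, Real.norm_eq_abs, abs_of_nonneg ht.1]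
      nlinarith [norm_nonneg z, ht.2]
    exact ⟨by simpa using lt_of_le_of_lt (by simpa using this) hz', this⟩
  have := norm_image_sub_le_of_norm_deriv_le_segment_01'
    (f := fun t : ℝ => F (0 + t • z))
    (f' := fun t : ℝ => Fx (0 + t • z) * z.1 + Fy (0 + t • z) * z.2) (C := 2 * C * ‖z‖ ^ (k + 1))
    (fun t ht => (HasGrad.line 0 z t (hball (hsub t ht).1).1).hasDerivWithinAt)
    (fun t ht => by
      have ht' : t ∈ Icc (0 : ℝ) 1 := ⟨ht.1, ht.2.le⟩
      obtain ⟨-, h1, h2⟩ := hball (hsub t ht').1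
      have hn := (hsub t ht').2
      have hp : C * ‖(0 : ℝ × ℝ) + t • z‖ ^ k ≤ C * ‖z‖ ^ k := by gcongr
      have n1 : |z.1| ≤ ‖z‖ := norm_fst_le z
      have n2 : |z.2| ≤ ‖z‖ := norm_snd_le z
      calc ‖Fx (0 + t • z) * z.1 + Fy (0 + t • z) * z.2‖
          ≤ |Fx (0 + t • z)| * |z.1| + |Fy (0 + t • z)| * |z.2| := by
            rw [← abs_mul, ← abs_mul]; exact abs_add_le _ _
        _ ≤ (C * ‖z‖ ^ k) * ‖z‖ + (C * ‖z‖ ^ k) * ‖z‖ := by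
            gcongr
            · exact h1.trans hp
            · exact h2.trans hp
        _ = 2 * C * ‖z‖ ^ (k + 1) := by ring)
  simpa using this

/-- The Hessian cannot vanish completely. -/
lemma lam_ne (D : Dat W U ux uy uxx uxy uyy uxxx uxxy uxyy uyyy)
    (hG : ∀ s, HasDerivAt G (f s) s) (hf : DifferentiableAt ℝ f (U 0))
    (h0 : (0 : ℝ × ℝ) ∈ W) (hx0 : ux 0 = 0) (hy0 : uy 0 = 0)
    (P : ℝ × ℝ → ℝ)
    (hP : P = fun z => (ux z * ux z + uy z * uy z) * (1 / 2) + G (U z))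
    (hU : ∀ᶠ p in nhds (0 : ℝ × ℝ), p ≠ 0 → U p < U 0)
    (hPs : ∀ᶠ p in nhds (0 : ℝ × ℝ), p ≠ 0 → P p < P 0) (hf0 : f (U 0) = 0) : False := by
  obtain ⟨C, hC, hfC⟩ : ∃ C, 0 ≤ C ∧ ∀ᶠ s in nhds (U 0), |f s| ≤ C * |s - U 0| ^ 1 := by
    obtain ⟨C, hC, hh⟩ := hf.isBigO_sub.exists_nonneg
    refine ⟨C, hC, ?_⟩
    have := hh.bound
    simpa [hf0] using this
  have hGq := pow_bound1 G f (U 0) C hC 1 (Eventually.of_forall hG) hfC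
  have hcU := (D.hU 0 h0).continuousAt
  have key : ∀ᶠ p in nhds (0 : ℝ × ℝ), |ux p| ≤ (2 * C + 1) * (U 0 - U p) := by
    filter_upwards [hcU.eventually hGq, hU, hPs] with p h1 h2 h3
    by_cases hp : p = 0
    · subst hp; simp [hx0]
    have h2 := h2 hp
    have h3 := h3 hp
    rw [hP] at h3
    simp only [hx0, hy0] at h3
    have i1 := (abs_le.1 h1).1
    norm_num at i1
    have hsq : ux p * ux p ≤ 2 * C * (U 0 - U p) ^ 2 := by
      have := mul_self_nonneg (uy p)
      nlinarith
    apply abs_le_of_sq_le_sq' _ _ |> abs_le.2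
    · nlinarith [sq_nonneg (U 0 - U p), mul_nonneg hC (sq_nonneg (U 0 - U p)), mul_nonneg (mul_nonneg hC hC) (sq_nonneg (U 0 - U p))]
    · exact mul_nonneg (by linarith) (by linarith)
  obtain ⟨ε, hε, hball⟩ := Metric.nhds_basis_closedBall.eventually_iff.1
    (key.and (hU.and (D.opn.mem_nhds h0)))
  have hmem : ∀ t ∈ Icc (0 : ℝ) ε, (0 : ℝ × ℝ) + t • ((1, 0) : ℝ × ℝ) ∈ closedBall (0 : ℝ × ℝ) ε := by
    intro t ht
    simp [Prod.norm_def, abs_of_nonneg ht.1, ht.2, hε.le]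
  set A := 2 * C + 1
  set h : ℝ → ℝ := fun t => Real.exp (-A * t) * (U 0 - U (0 + t • ((1, 0) : ℝ × ℝ))) with hh
  have hder : ∀ t ∈ Icc (0 : ℝ) ε, HasDerivAt h
      (Real.exp (-A * t) * (-A) * (U 0 - U (0 + t • ((1, 0) : ℝ × ℝ)))
        + Real.exp (-A * t) * (- ux (0 + t • ((1, 0) : ℝ × ℝ)))) t := by
    intro t ht
    have a1 : HasDerivAt (fun t : ℝ => Real.exp (-A * t)) (Real.exp (-A * t) * (-A)) t := by
      have := ((hasDerivAt_id t).const_mul (-A)).exp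
      simpa using this
    have a2 := (HasGrad.line 0 (1, 0) t (D.hU _ (hball (hmem t ht)).2.2)).const_sub (U 0)
    refine HasDerivAt.congr_deriv (a1.mul a2) ?_
    simp
  have hanti : AntitoneOn h (Icc 0 ε) := by
    apply antitoneOn_of_deriv_nonpos (convex_Icc 0 ε)
    · exact fun t ht => (hder t ht).continuousAt.continuousWithinAt
    · intro t ht
      rw [interior_Icc] at ht
      exact (hder t ⟨ht.1.le, ht.2.le⟩).differentiableAt.differentiableWithinAt
    · intro t ht
      rw [interior_Icc] at ht
      have ht' : t ∈ Icc (0 : ℝ) ε := ⟨ht.1.le, ht.2.le⟩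
      rw [(hder t ht').deriv]
      have k1 := (abs_le.1 (hball (hmem t ht')).1).1
      have k2 := Real.exp_pos (-A * t)
      nlinarith
  have h1 := hanti (left_mem_Icc.2 hε.le) (right_mem_Icc.2 hε.le) hε.le
  have h2 := (hball (hmem ε (right_mem_Icc.2 hε.le))).2.1 (by simp [Prod.ext_iff, hε.ne'])
  have h3 : 0 < h ε := mul_pos (Real.exp_pos _) (by linarith)
  have h4 : h 0 = 0 := by
    simp only [hh, zero_smul, add_zero, sub_self, mul_zero]
  linarith

end core

section core

variable {W : Set (ℝ × ℝ)} {U ux uy uxx uxy uyy uxxx uxxy uxyy uyyy : ℝ × ℝ → ℝ}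
  {f G : ℝ → ℝ}

/-- Local expansions at a degenerate critical point. -/
lemma expansions (D : Dat W U ux uy uxx uxy uyy uxxx uxxy uxyy uyyy)
    (h0 : (0 : ℝ × ℝ) ∈ W) (hx0 : ux 0 = 0) (hy0 : uy 0 = 0) (hxx0 : uxx 0 = 0) (hxy0 : uxy 0 = 0)
    (L : ℝ) (hyy0 : uyy 0 = -L) :
    ∃ A, 0 ≤ A ∧ ∀ᶠ z in nhds (0 : ℝ × ℝ), |uxx z| ≤ A * ‖z‖ ∧ |uxy z| ≤ A * ‖z‖ ∧
      |uyy z + L| ≤ A * ‖z‖ ∧ |ux z| ≤ A * ‖z‖ ^ 2 ∧ |uy z + L * z.2| ≤ A * ‖z‖ ^ 2 := by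
  obtain ⟨A1, hA1, h1⟩ := (D.huxx 0 h0).bigO
  obtain ⟨A2, hA2, h2⟩ := (D.huxy 0 h0).bigO
  obtain ⟨A3, hA3, h3⟩ := (D.huyy 0 h0).bigO
  simp only [hxx0, hxy0, hyy0, sub_zero, sub_neg_eq_add] at h1 h2 h3
  set A := A1 + A2 + A3 with hA
  have hA0 : 0 ≤ A := by positivity
  have hW := D.opn.mem_nhds h0
  have g1 : ∀ᶠ z in nhds (0 : ℝ × ℝ), |uxx z| ≤ A * ‖z‖ ^ 1 := h1.mono fun z hz => hz.trans (by
    rw [pow_one]; gcongr; linarith)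
  have g2 : ∀ᶠ z in nhds (0 : ℝ × ℝ), |uxy z| ≤ A * ‖z‖ ^ 1 := h2.mono fun z hz => hz.trans (by
    rw [pow_one]; gcongr; linarith)
  have g3 : ∀ᶠ z in nhds (0 : ℝ × ℝ), |uyy z + L| ≤ A * ‖z‖ ^ 1 := h3.mono fun z hz => hz.trans (by
    rw [pow_one]; gcongr; linarith)
  have g4 := pow_bound2 ux uxx uxy A hA0 1 (by filter_upwards [hW] with z hz using D.hux z hz) g1 g2
  have g5 := pow_bound2 (fun z => uy z + L * z.2) uxy (fun z => uyy z + L) A hA0 1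
    (by
      filter_upwards [hW] with z hz
      exact ((D.huy z hz).add (HasGrad.snd.const_mul L)).congr (by ring) (by ring)) g2 g3
  refine ⟨2 * A, by positivity, ?_⟩
  filter_upwards [g1, g2, g3, g4, g5] with z k1 k2 k3 k4 k5
  have hn : 0 ≤ A * ‖z‖ := by positivity
  simp only [pow_one] at k1 k2 k3
  simp [hx0] at k4
  simp [hy0] at k5
  exact ⟨by linarith, by linarith, by linarith, k4, k5⟩

/-- Algebraic estimate for the barrier, abstract form. -/
lemma barrier_aux (L C x y R bx bY : ℝ) (hC0 : 0 ≤ C) (hy : 0 < y)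
    (hxy : x ^ 2 ≤ 2 * y ^ 2)
    (e1 : |R - L ^ 2 * y ^ 2| ≤ C * y ^ 3) (e2 : |bx| ≤ C * y ^ 2)
    (e3 : |bY - 2 * L ^ 2 * y| ≤ C * y ^ 2)
    (hsmall : 14 * C * y < 3 / 4 * L ^ 2) :
    0 < R * (31 / 4 * y - 3 / 8 * x ^ 2 / y)
      + bx * (x * y) - bY * (7 / 2 * y ^ 2 - 3 / 4 * x ^ 2) := by
  have hxy' : x ^ 2 / y ≤ 2 * y := by
    rw [div_le_iff₀ hy]; linarith
  have hxy0 : 0 ≤ x ^ 2 / y := by positivity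
  obtain ⟨k1, hk1⟩ : ∃ k1, k1 = 31 / 4 * y - 3 / 8 * x ^ 2 / y := ⟨_, rfl⟩
  have hk1a : 0 ≤ k1 ∧ k1 ≤ 8 * y := by
    have : 3 / 8 * x ^ 2 / y = 3 / 8 * (x ^ 2 / y) := by ring
    rw [hk1, this]
    constructor <;> linarith
  obtain ⟨k2, hk2⟩ : ∃ k2, k2 = 7 / 2 * y ^ 2 - 3 / 4 * x ^ 2 := ⟨_, rfl⟩
  have hk2a : 0 ≤ k2 ∧ k2 ≤ 4 * y ^ 2 := by
    rw [hk2]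
    constructor <;> linarith [sq_nonneg x, sq_nonneg y]
  have hxa : |x| ≤ 2 * y := by
    apply abs_le_of_sq_le_sq _ (by positivity)
    linarith [sq_nonneg y, show (2 * y) ^ 2 = 4 * y ^ 2 by ring]
  rw [← hk1, ← hk2]
  have f1 : -(C * y ^ 3 * (8 * y)) ≤ (R - L ^ 2 * y ^ 2) * k1 := by
    have : |(R - L ^ 2 * y ^ 2) * k1| ≤ C * y ^ 3 * (8 * y) := by
      rw [abs_mul, abs_of_nonneg hk1a.1]
      exact mul_le_mul e1 hk1a.2 hk1a.1 (by positivity)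
    exact (abs_le.1 this).1
  have f2 : -(C * y ^ 2 * (2 * y * y)) ≤ bx * (x * y) := by
    have : |bx * (x * y)| ≤ C * y ^ 2 * (2 * y * y) := by
      rw [abs_mul, abs_mul, abs_of_pos hy]
      gcongr
    exact (abs_le.1 this).1
  have f3 : (bY - 2 * L ^ 2 * y) * k2 ≤ C * y ^ 2 * (4 * y ^ 2) := by
    have : |(bY - 2 * L ^ 2 * y) * k2| ≤ C * y ^ 2 * (4 * y ^ 2) := by
      rw [abs_mul, abs_of_nonneg hk2a.1]
      exact mul_le_mul e3 hk2a.2 hk2a.1 (by positivity)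
    exact (abs_le.1 this).2
  have main : L ^ 2 * y ^ 2 * k1 - 2 * L ^ 2 * y * k2
      = L ^ 2 * (3 / 4 * y ^ 3 + 9 / 8 * x ^ 2 * y) := by
    rw [hk1, hk2]
    field_simp
    ring
  have hm2 : L ^ 2 * (3 / 4 * y ^ 3) ≤ L ^ 2 * (3 / 4 * y ^ 3 + 9 / 8 * x ^ 2 * y) := by
    have : 0 ≤ 9 / 8 * x ^ 2 * y := by positivity
    gcongr
    linarith
  have hm3 : 14 * C * y * y ^ 3 < 3 / 4 * L ^ 2 * y ^ 3 := by
    have : 0 < y ^ 3 := by positivity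
    gcongr
  have e : R * k1 + bx * (x * y) - bY * k2 = (R - L ^ 2 * y ^ 2) * k1 + bx * (x * y)
      - (bY - 2 * L ^ 2 * y) * k2 + (L ^ 2 * y ^ 2 * k1 - 2 * L ^ 2 * y * k2) := by ring
  rw [e, main]
  have q1 : C * y ^ 3 * (8 * y) = 8 * (C * y ^ 4) := by ring
  have q2 : C * y ^ 2 * (2 * y * y) = 2 * (C * y ^ 4) := by ring
  have q3 : C * y ^ 2 * (4 * y ^ 2) = 4 * (C * y ^ 4) := by ring
  have q4 : 14 * C * y * y ^ 3 = 14 * (C * y ^ 4) := by ring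
  have q5 : 3 / 4 * L ^ 2 * y ^ 3 = L ^ 2 * (3 / 4 * y ^ 3) := by ring
  rw [q1] at f1
  rw [q2] at f2
  rw [q3] at f3
  rw [q4, q5] at hm3
  linarith

/-- Algebraic estimate for the barrier. -/
lemma barrier_pos (L A x y a b c t w : ℝ) (hL : L ≠ 0) (hA : 0 ≤ A) (hy : 0 < y) (hy1 : y ≤ 1)
    (hxy : x ^ 2 ≤ 2 * y ^ 2)
    (ha : |a| ≤ A * y) (hb : |b| ≤ A * y) (hc : |c + L| ≤ A * y) (ht : |t| ≤ A * y ^ 2)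
    (hw : |w + L * y| ≤ A * y ^ 2)
    (hsmall : 14 * (4 * |L| * A + 4 * A ^ 2) * y < 3 / 4 * L ^ 2) :
    0 < (t * t + w * w) * (31 / 4 * y - 3 / 8 * x ^ 2 / y)
      + 2 * (t * a + w * b) * (x * y) - 2 * (t * b + w * c) * (7 / 2 * y ^ 2 - 3 / 4 * x ^ 2) := by
  obtain ⟨C, hC⟩ : ∃ C, C = 4 * |L| * A + 4 * A ^ 2 := ⟨_, rfl⟩
  rw [← hC] at hsmall
  have hC0 : 0 ≤ C := by rw [hC]; positivity
  have hyA : A * y ^ 2 ≤ A * y := by nlinarith [mul_nonneg hA hy.le]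
  have hAy0 : 0 ≤ A * y := by positivity
  have hL0 := abs_nonneg L
  -- bounds
  have e1 : |t * t + w * w - L ^ 2 * y ^ 2| ≤ C * y ^ 3 := by
    have : t * t + w * w - L ^ 2 * y ^ 2
      = t * t + (w + L * y) * (w + L * y) - 2 * (L * y) * (w + L * y) := by ring
    rw [this]
    have b1 : |t * t| ≤ (A * y ^ 2) * (A * y) := by
      rw [abs_mul]; exact mul_le_mul ht (ht.trans hyA) (abs_nonneg _) (by positivity)
    have b2 : |(w + L * y) * (w + L * y)| ≤ (A * y ^ 2) * (A * y) := by
      rw [abs_mul]; exact mul_le_mul hw (hw.trans hyA) (abs_nonneg _) (by positivity)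
    have b3 : |2 * (L * y) * (w + L * y)| ≤ 2 * (|L| * y) * (A * y ^ 2) := by
      rw [abs_mul, abs_mul, abs_mul, abs_of_pos hy, abs_two]; gcongr
    have := (abs_sub _ _).trans (add_le_add ((abs_add_le _ _).trans (add_le_add b1 b2)) b3)
    refine this.trans ?_
    rw [hC]
    have : 0 ≤ |L| * A * y ^ 3 := by positivity
    have : 0 ≤ A ^ 2 * y ^ 3 := by positivity
    nlinarith
  have e2 : |2 * (t * a + w * b)| ≤ C * y ^ 2 := by
    have : 2 * (t * a + w * b) = 2 * (t * a + (w + L * y) * b - L * y * b) := by ring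
    rw [this, abs_mul, abs_two]
    have b1 : |t * a| ≤ (A * y) * (A * y) := by
      rw [abs_mul]; exact mul_le_mul (ht.trans hyA) ha (abs_nonneg _) (by positivity)
    have b2 : |(w + L * y) * b| ≤ (A * y) * (A * y) := by
      rw [abs_mul]; exact mul_le_mul (hw.trans hyA) hb (abs_nonneg _) (by positivity)
    have b3 : |L * y * b| ≤ (|L| * y) * (A * y) := by
      rw [abs_mul, abs_mul, abs_of_pos hy]; gcongr
    have := (abs_sub _ _).trans (add_le_add ((abs_add_le _ _).trans (add_le_add b1 b2)) b3)
    rw [hC]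
    have : 0 ≤ |L| * A * y ^ 2 := by positivity
    have : 0 ≤ A ^ 2 * y ^ 2 := by positivity
    nlinarith
  have e3 : |2 * (t * b + w * c) - 2 * L ^ 2 * y| ≤ C * y ^ 2 := by
    have : 2 * (t * b + w * c) - 2 * L ^ 2 * y
      = 2 * (t * b + (w + L * y) * (c + L) - ((w + L * y) * L + L * y * (c + L))) := by ring
    rw [this, abs_mul, abs_two]
    have b1 : |t * b| ≤ (A * y) * (A * y) := by
      rw [abs_mul]; exact mul_le_mul (ht.trans hyA) hb (abs_nonneg _) (by positivity)
    have b2 : |(w + L * y) * (c + L)| ≤ (A * y) * (A * y) := by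
      rw [abs_mul]; exact mul_le_mul (hw.trans hyA) hc (abs_nonneg _) (by positivity)
    have b3 : |(w + L * y) * L| ≤ (A * y ^ 2) * |L| := by
      rw [abs_mul]; gcongr
    have b4 : |L * y * (c + L)| ≤ (|L| * y) * (A * y) := by
      rw [abs_mul, abs_mul, abs_of_pos hy]; gcongr
    have := (abs_sub _ _).trans (add_le_add ((abs_add_le _ _).trans (add_le_add b1 b2))
      ((abs_add_le _ _).trans (add_le_add b3 b4)))
    rw [hC]
    have : 0 ≤ |L| * A * y ^ 2 := by positivity
    have : 0 ≤ A ^ 2 * y ^ 2 := by positivity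
    nlinarith
  exact barrier_aux L C x y _ _ _ hC0 hy hxy e1 e2 e3 hsmall

set_option maxHeartbeats 1600000 in
/-- The barrier argument at the origin. -/
lemma sector (D : Dat W U ux uy uxx uxy uyy uxxx uxxy uxyy uyyy)
    (hG : ∀ s, HasDerivAt G (f s) s)
    (hpde : ∀ p ∈ W, -(uxx p + uyy p) = f (U p)) (P : ℝ × ℝ → ℝ)
    (hP : P = fun z => (ux z * ux z + uy z * uy z) * (1 / 2) + G (U z))
    (h0 : (0 : ℝ × ℝ) ∈ W) (hx0 : ux 0 = 0) (hy0 : uy 0 = 0) (hxx0 : uxx 0 = 0) (hxy0 : uxy 0 = 0)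
    (L : ℝ) (hyy0 : uyy 0 = -L) (hL : L ≠ 0)
    (hPs : ∀ᶠ p in nhds (0 : ℝ × ℝ), p ≠ 0 → P p < P 0) :
    ∃ δ > 0, ∃ ε > 0, ∀ y : ℝ, 0 ≤ y → y ≤ ε → P (0, y) + δ * (√y * y ^ 3) ≤ P 0 := by
  obtain ⟨A0, hA0, hexp⟩ := expansions D h0 hx0 hy0 hxx0 hxy0 L hyy0
  set A := 4 * A0 with hA
  have hA' : 0 ≤ A := by positivity
  obtain ⟨ρ, hρ, hball⟩ := Metric.nhds_basis_ball.eventually_iff.1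
    (hexp.and (hPs.and (D.opn.mem_nhds h0)))
  set C := 4 * |L| * A + 4 * A ^ 2 with hC
  have hC0 : 0 ≤ C := by positivity
  have hL2 : 0 < L ^ 2 := by positivity
  obtain ⟨ε, hε, hε1, hερ, hεs⟩ : ∃ ε : ℝ, 0 < ε ∧ ε ≤ 1 ∧ 2 * ε < ρ ∧ 14 * C * ε < 3 / 4 * L ^ 2 := by
    refine ⟨min 1 (min (ρ / 4) (3 / 4 * L ^ 2 / (14 * C + 1) / 2)), by positivity, min_le_left _ _, ?_, ?_⟩
    · have : min 1 (min (ρ / 4) (3 / 4 * L ^ 2 / (14 * C + 1) / 2)) ≤ ρ / 4 :=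
        (min_le_right _ _).trans (min_le_left _ _)
      linarith
    · have h1 : min 1 (min (ρ / 4) (3 / 4 * L ^ 2 / (14 * C + 1) / 2)) ≤ 3 / 4 * L ^ 2 / (14 * C + 1) / 2 :=
        (min_le_right _ _).trans (min_le_right _ _)
      have h2 : 14 * C * (3 / 4 * L ^ 2 / (14 * C + 1)) ≤ 3 / 4 * L ^ 2 := by
        rw [← mul_div_assoc, div_le_iff₀ (by positivity)]
        nlinarith
      have h3 : 14 * C * min 1 (min (ρ / 4) (3 / 4 * L ^ 2 / (14 * C + 1) / 2)) ≤ 14 * C * (3 / 4 * L ^ 2 / (14 * C + 1) / 2) := by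
        gcongr
      linarith
  set K : Set (ℝ × ℝ) := {z | 0 ≤ z.2 ∧ z.2 ≤ ε ∧ z.1 ^ 2 ≤ 2 * z.2 ^ 2} with hK
  have hnorm : ∀ z ∈ K, ‖z‖ ≤ 2 * z.2 := by
    rintro z ⟨h1, h2, h3⟩
    rw [Prod.norm_def]
    apply max_le
    · rw [Real.norm_eq_abs]
      apply abs_le_of_sq_le_sq _ (by positivity)
      nlinarith [sq_nonneg z.2]
    · rw [Real.norm_eq_abs, abs_of_nonneg h1]; linarith
  have hKb : K ⊆ ball 0 ρ := by
    intro z hz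
    have := hnorm z hz
    have := hz.2.1
    simp only [mem_ball, dist_zero_right]
    linarith
  have hKcl : IsClosed K := by
    apply IsClosed.inter
    · exact isClosed_le continuous_const continuous_snd
    apply IsClosed.inter
    · exact isClosed_le continuous_snd continuous_const
    · have : IsClosed {z : ℝ × ℝ | z.1 ^ 2 ≤ 2 * z.2 ^ 2} := isClosed_le (by fun_prop) (by fun_prop)
      exact this
  have hKc : IsCompact K :=
    (isCompact_closedBall (0 : ℝ × ℝ) ρ).of_isClosed_subset hKcl (hKb.trans ball_subset_closedBall)
  have hW : ∀ z ∈ K, z ∈ W := fun z hz => (hball (hKb hz)).2.2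
  have hcP : ContinuousOn P K := by
    intro p hp
    rw [hP]; exact (gradP D hG hpde p (hW p hp)).continuousAt.continuousWithinAt
  set η : ℝ × ℝ → ℝ := fun z => √z.2 * (z.2 ^ 3 - 1 / 2 * z.1 ^ 2 * z.2) with hη
  have hcη : Continuous η := by simp only [hη]; fun_prop
  have hPle : ∀ z ∈ K, P z ≤ P 0 := by
    intro z hz
    by_cases h : z = 0
    · rw [h]
    · exact ((hball (hKb hz)).2.1 h).le
  -- the top edge
  have hTc : IsCompact (K ∩ {z | z.2 = ε}) :=
    hKc.inter_right (isClosed_eq continuous_snd continuous_const)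
  obtain ⟨T, hT, hTm⟩ := hTc.exists_isMaxOn ⟨(0, ε), ⟨by simp [hK]; exact ⟨hε.le, by positivity⟩, rfl⟩⟩
    (hcP.mono inter_subset_left)
  have hTlt : P T < P 0 := (hball (hKb hT.1)).2.1 (by
    rintro rfl
    have : (0 : ℝ) = ε := hT.2
    linarith)
  obtain ⟨B, hB⟩ := hKc.exists_bound_of_continuousOn hcη.continuousOn
  have hB0 : 0 ≤ B := (norm_nonneg _).trans (hB T hT.1)
  set δ := (P 0 - P T) / (B + 1) with hδ
  have hδ0 : 0 < δ := div_pos (by linarith) (by positivity)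
  have hδB : δ * B < P 0 - P T := by
    rw [hδ, div_mul_eq_mul_div, div_lt_iff₀ (by positivity)]
    nlinarith
  obtain ⟨p, hp, hpm⟩ := hKc.exists_isMaxOn ⟨T, hT.1⟩
    (hcP.add (hcη.continuousOn.const_mul δ) (f := P) (g := fun z => δ * η z))
  have hpm' : ∀ z ∈ K, P z + δ * η z ≤ P p + δ * η p := fun z hz => hpm hz
  have hfin : P p + δ * η p ≤ P 0 := by
    by_contra hcon
    push Not at hcon
    have hη_pos : 0 < η p := by
      have := hPle p hp
      by_contra h
      push Not at h
      nlinarith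
    have hy : 0 < p.2 := by
      rcases hp.1.lt_or_eq with h | h
      · exact h
      · simp [hη, ← h] at hη_pos
    have hx : p.1 ^ 2 < 2 * p.2 ^ 2 := by
      have h1 := (pos_iff_pos_of_mul_pos hη_pos).1 (Real.sqrt_pos.2 hy)
      by_contra h
      push Not at h
      nlinarith
    have hye : p.2 < ε := by
      rcases hp.2.1.lt_or_eq with h | h
      · exact h
      · exfalso
        have i1 : P p ≤ P T := hTm ⟨hp, h⟩
        have i2 : η p ≤ B := (le_abs_self _).trans (hB p hp)
        nlinarith
    have hKn : K ∈ nhds p := by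
      have o1 : IsOpen {z : ℝ × ℝ | 0 < z.2} := isOpen_lt continuous_const continuous_snd
      have o2 : IsOpen {z : ℝ × ℝ | z.2 < ε} := isOpen_lt continuous_snd continuous_const
      have o3 : IsOpen {z : ℝ × ℝ | z.1 ^ 2 < 2 * z.2 ^ 2} := isOpen_lt (by fun_prop) (by fun_prop)
      filter_upwards [o1.mem_nhds hy, o2.mem_nhds hye, o3.mem_nhds hx] with z h1 h2 h3
      exact ⟨le_of_lt h1, le_of_lt h2, le_of_lt h3⟩
    have hloc : IsLocalMax (P + fun z => δ * η z) p := hpm.isLocalMax hKn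
    rw [hP] at hloc
    have hS : ∀ z : ℝ × ℝ, 0 < z.2 → HasGrad (fun z : ℝ × ℝ => √z.2) 0 (√z.2 / (2 * z.2)) z := by
      intro z hz
      have := HasGrad.comp1 (F := fun z : ℝ × ℝ => z.2) (Real.hasDerivAt_sqrt hz.ne') HasGrad.snd (p := z)
      refine this.congr (by ring) ?_
      have h1 : √z.2 * √z.2 = z.2 := Real.mul_self_sqrt hz.le
      have h2 : 0 < √z.2 := Real.sqrt_pos.2 hz
      field_simp
      nlinarith
    have X : ∀ z : ℝ × ℝ, HasGrad (fun z : ℝ × ℝ => z.1) 1 0 z := fun z => HasGrad.fst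
    have Y : ∀ z : ℝ × ℝ, HasGrad (fun z : ℝ × ℝ => z.2) 0 1 z := fun z => HasGrad.snd
    have X2 : ∀ z : ℝ × ℝ, HasGrad (fun z : ℝ × ℝ => z.1 ^ 2) (2 * z.1) 0 z := fun z =>
      HasGrad.congr (HasGrad.congrF ((X z).mul (X z)) (Eventually.of_forall fun w => by ring)) (by ring) (by ring)
    have Y2 : ∀ z : ℝ × ℝ, HasGrad (fun z : ℝ × ℝ => z.2 ^ 2) 0 (2 * z.2) z := fun z =>
      HasGrad.congr (HasGrad.congrF ((Y z).mul (Y z)) (Eventually.of_forall fun w => by ring)) (by ring) (by ring)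
    have Y3 : ∀ z : ℝ × ℝ, HasGrad (fun z : ℝ × ℝ => z.2 ^ 3) 0 (3 * z.2 ^ 2) z := fun z =>
      HasGrad.congr (HasGrad.congrF ((Y2 z).mul (Y z)) (Eventually.of_forall fun w => by ring)) (by ring) (by ring)
    refine touchP D hG hpde p (hW p hp) η (fun z => √z.2 * (-(z.1 * z.2)))
      (fun z => √z.2 * (7 / 2 * z.2 ^ 2 - 3 / 4 * z.1 ^ 2)) _ _ _ _ δ hδ0 ?_
      ((hS p hy).mul ((X p).mul (Y p)).neg)
      ((hS p hy).mul (((Y2 p).const_mul (7 / 2)).sub ((X2 p).const_mul (3 / 4)))) ?_ hloc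
    · have o1 : IsOpen {z : ℝ × ℝ | 0 < z.2} := isOpen_lt continuous_const continuous_snd
      filter_upwards [o1.mem_nhds hy] with z hz
      have hz : 0 < z.2 := hz
      refine ((hS z hz).mul ((Y3 z).sub (((X2 z).const_mul (1 / 2)).mul (Y z)))).congr ?_ ?_
      · ring
      · field_simp
        ring
    · obtain ⟨⟨k1, k2, k3, k4, k5⟩, -⟩ := hball (hKb hp)
      have hn := hnorm p hp
      have m1 : A0 * ‖p‖ ≤ A * p.2 := by
        have : A0 * ‖p‖ ≤ A0 * (2 * p.2) := by gcongr
        have := mul_nonneg hA0 hy.le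
        rw [hA]; linarith
      have m2 : A0 * ‖p‖ ^ 2 ≤ A * p.2 ^ 2 := by
        have : A0 * ‖p‖ ^ 2 ≤ A0 * (2 * p.2) ^ 2 := by gcongr
        rw [hA]; linarith
      have hs : 14 * C * p.2 < 3 / 4 * L ^ 2 := by
        have : 14 * C * p.2 ≤ 14 * C * ε := by gcongr
        linarith
      have key := barrier_pos L A p.1 p.2 (uxx p) (uxy p) (uyy p) (ux p) (uy p) hL hA' hy
        (hye.le.trans hε1) hx.le (k1.trans m1) (k2.trans m1) (k3.trans m1) (k4.trans m2)
        (k5.trans m2) hs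
      have key2 := mul_pos (Real.sqrt_pos.2 hy) key
      refine key2.trans_eq ?_
      field_simp
      ring
  refine ⟨δ, hδ0, ε, hε, fun y hy hyε => ?_⟩
  have hy2 : (0 : ℝ) ^ 2 ≤ 2 * y ^ 2 := by nlinarith [sq_nonneg y]
  have := hpm' (0, y) ⟨hy, hyε, hy2⟩
  have e : η (0, y) = √y * y ^ 3 := by simp [hη]
  rw [e] at this
  linarith

/-- The core theorem in adapted coordinates. -/
lemma core_thm (D : Dat W U ux uy uxx uxy uyy uxxx uxxy uxyy uyyy)
    (hf : Differentiable ℝ f)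
    (hpde : ∀ p ∈ W, -(uxx p + uyy p) = f (U p))
    (h0 : (0 : ℝ × ℝ) ∈ W) (hx0 : ux 0 = 0) (hy0 : uy 0 = 0) (hxx0 : uxx 0 = 0) (hxy0 : uxy 0 = 0)
    (hdiff : DifferentiableAt ℝ uxxy 0)
    (huniq : ∀ p ∈ W, ux p = 0 → uy p = 0 → p = 0) (c : ℝ) (hc : c < U 0)
    (hcomp : IsCompact {p | p ∈ W ∧ c ≤ U p})
    (hcurv : ∀ p ∈ W, U p = c →
      uxx p * uy p ^ 2 - 2 * uxy p * ux p * uy p + uyy p * ux p ^ 2 < 0) : False := by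
  set G : ℝ → ℝ := fun s => ∫ t in (0 : ℝ)..s, f t with hGdef
  have hG : ∀ s, HasDerivAt G (f s) s := fun s =>
    (hf.continuous.integral_hasStrictDerivAt 0 s).hasDerivAt
  set P : ℝ × ℝ → ℝ := fun z => (ux z * ux z + uy z * uy z) * (1 / 2) + G (U z) with hP
  obtain ⟨hUs, hPs⟩ := strictP D hG hpde P hP h0 huniq c hc hcomp hcurv
  set L := - uyy 0 with hLdef
  have hyy0 : uyy 0 = -L := by simp [hLdef]
  have hL : L ≠ 0 := by
    intro h
    refine lam_ne D hG (hf _) h0 hx0 hy0 P hP hUs hPs ?_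
    rw [← hpde 0 h0, hxx0, hyy0, h]; simp
  obtain ⟨δ, hδ, ε, hε, hbar⟩ := sector D hG hpde P hP h0 hx0 hy0 hxx0 hxy0 L hyy0 hL hPs
  obtain ⟨A, hA, hexp⟩ := expansions D h0 hx0 hy0 hxx0 hxy0 L hyy0
  set κ := uxxy 0 with hκ
  have hline : Tendsto (fun s : ℝ => (0 : ℝ × ℝ) + s • ((0, 1) : ℝ × ℝ)) (nhds 0) (nhds 0) := by
    have : Continuous (fun s : ℝ => (0 : ℝ × ℝ) + s • ((0, 1) : ℝ × ℝ)) := by fun_prop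
    simpa using this.tendsto 0
  have hnorm : ∀ s : ℝ, ‖(0 : ℝ × ℝ) + s • ((0, 1) : ℝ × ℝ)‖ = |s| := by
    intro s; simp [Prod.norm_def]
  obtain ⟨A2, hA2, hz⟩ : ∃ C, 0 ≤ C ∧ ∀ᶠ z in nhds (0 : ℝ × ℝ), |uxxy z - κ| ≤ C * ‖z‖ := by
    obtain ⟨C, hC, hh⟩ := hdiff.isBigO_sub.exists_nonneg
    refine ⟨C, hC, ?_⟩
    have := hh.bound
    simpa using this
  have hWl := hline.eventually (D.opn.mem_nhds h0)
  -- expansion of `uxx` on the axis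
  have hxxl : ∀ᶠ s in nhds (0 : ℝ), |uxx (0 + s • ((0, 1) : ℝ × ℝ)) - κ * s| ≤ A2 * |s| ^ 2 := by
    have := pow_bound1 (fun s : ℝ => uxx (0 + s • ((0, 1) : ℝ × ℝ)) - κ * s)
      (fun s : ℝ => uxxy (0 + s • ((0, 1) : ℝ × ℝ)) - κ) 0 A2 hA2 1
      (by
        filter_upwards [hWl] with s hs
        have a1 := HasGrad.line 0 (0, 1) s (D.huxx _ hs)
        have a2 := (hasDerivAt_id s).const_mul κ
        refine HasDerivAt.congr_deriv (a1.sub a2) ?_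
        simp)
      (by
        filter_upwards [hline.eventually hz] with s hs
        rw [hnorm] at hs
        simpa using hs)
    filter_upwards [this] with s hs
    have e0 : (0 : ℝ × ℝ) + (0 : ℝ) • ((0, 1) : ℝ × ℝ) = 0 := by simp
    simp only [e0, hxx0, mul_zero, sub_zero] at hs
    exact hs
  -- expansion of `P` on the axis
  set K := L * κ with hK
  set B := |κ| * A + A * A + (|L| + A) * A2 with hB
  have hB0 : 0 ≤ B := by positivity
  have hPl : ∀ᶠ s in nhds (0 : ℝ), |P (0 + s • ((0, 1) : ℝ × ℝ)) - P 0 - K / 3 * s ^ 3| ≤ B * |s| ^ 4 := by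
    have := pow_bound1 (fun s : ℝ => P (0 + s • ((0, 1) : ℝ × ℝ)) - K / 3 * s ^ 3)
      (fun s : ℝ => (ux (0 + s • ((0, 1) : ℝ × ℝ)) * uxy (0 + s • ((0, 1) : ℝ × ℝ))
        - uy (0 + s • ((0, 1) : ℝ × ℝ)) * uxx (0 + s • ((0, 1) : ℝ × ℝ))) - K * s ^ 2) 0 B hB0 3
      (by
        filter_upwards [hWl] with s hs
        have a1 := HasGrad.line 0 (0, 1) s (gradP D hG hpde _ hs)
        have a2 := (hasDerivAt_pow 3 s).const_mul (K / 3)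
        refine HasDerivAt.congr_deriv (a1.sub a2) ?_
        simp
        ring)
      (by
        filter_upwards [hline.eventually hexp, hxxl, Metric.ball_mem_nhds (0 : ℝ) one_pos]
          with s hE k6 k7
        obtain ⟨-, k2, -, k4, k5⟩ := hE
        have hs1 : |s| ≤ 1 := by
          have := mem_ball.1 k7
          rw [Real.dist_eq, sub_zero] at this
          exact this.le
        rw [hnorm] at k2 k4 k5
        set z := (0 : ℝ × ℝ) + s • ((0, 1) : ℝ × ℝ) with hzdef
        have hz2 : z.2 = s := by simp [hzdef]
        rw [hz2] at k5
        have hs0 := abs_nonneg s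
        have e : ux z * uxy z - uy z * uxx z - K * s ^ 2
          = ux z * uxy z - (uy z + L * s) * (uxx z - κ * s) - (uy z + L * s) * (κ * s)
            + L * s * (uxx z - κ * s) := by rw [hK]; ring
        rw [e, sub_zero]
        have b1 : |ux z * uxy z| ≤ A * |s| ^ 2 * (A * |s|) := by
          rw [abs_mul]; gcongr
        have b2 : |(uy z + L * s) * (uxx z - κ * s)| ≤ A * |s| ^ 2 * (A2 * |s| ^ 2) := by
          rw [abs_mul]; gcongr
        have b3 : |(uy z + L * s) * (κ * s)| ≤ A * |s| ^ 2 * (|κ| * |s|) := by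
          rw [abs_mul, abs_mul κ]; gcongr
        have b4 : |L * s * (uxx z - κ * s)| ≤ |L| * |s| * (A2 * |s| ^ 2) := by
          rw [abs_mul, abs_mul L]; gcongr
        have b5 : A * |s| ^ 2 * (A2 * |s| ^ 2) ≤ A * A2 * |s| ^ 3 := by
          have h4 : |s| ^ 4 ≤ |s| ^ 3 := pow_le_pow_of_le_one hs0 hs1 (by norm_num)
          have : A * |s| ^ 2 * (A2 * |s| ^ 2) = A * A2 * |s| ^ 4 := by ring
          rw [this]; gcongr
        have t1 := abs_add_le (ux z * uxy z - (uy z + L * s) * (uxx z - κ * s) - (uy z + L * s) * (κ * s))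
          (L * s * (uxx z - κ * s))
        have t2 := abs_sub (ux z * uxy z - (uy z + L * s) * (uxx z - κ * s)) ((uy z + L * s) * (κ * s))
        have t3 := abs_sub (ux z * uxy z) ((uy z + L * s) * (uxx z - κ * s))
        have : B * |s| ^ 3 = A * |s| ^ 2 * (A * |s|) + A * A2 * |s| ^ 3 + A * |s| ^ 2 * (|κ| * |s|)
          + |L| * |s| * (A2 * |s| ^ 2) := by rw [hB]; ring
        rw [this]
        linarith)
    filter_upwards [this] with s hs
    have e0 : (0 : ℝ × ℝ) + (0 : ℝ) • ((0, 1) : ℝ × ℝ) = 0 := by simp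
    simp only [e0, sub_zero] at hs
    convert hs using 2
    ring
  have hPle : ∀ᶠ s in nhds (0 : ℝ), P (0 + s • ((0, 1) : ℝ × ℝ)) ≤ P 0 := by
    filter_upwards [hline.eventually hPs] with s hs
    by_cases h : (0 : ℝ × ℝ) + s • ((0, 1) : ℝ × ℝ) = 0
    · rw [h]
    · exact (hs h).le
  obtain ⟨r, hr, hball⟩ := Metric.nhds_basis_ball.eventually_iff.1 (hPl.and hPle)
  have hKle : ∀ s : ℝ, |s| < r → K / 3 * s ^ 3 ≤ B * |s| ^ 4 := by
    intro s hs
    obtain ⟨i1, i2⟩ := hball (x := s) (by simpa using hs)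
    have := (abs_le.1 i1).1
    linarith
  have hKabs : ∀ s : ℝ, 0 < s → s < r → |K| / 3 ≤ B * s := by
    intro s hs hsr
    have j1 := hKle s (by rw [abs_of_pos hs]; exact hsr)
    have j2 := hKle (-s) (by rw [abs_neg, abs_of_pos hs]; exact hsr)
    rw [abs_neg] at j2
    rw [abs_of_pos hs] at j1 j2
    have hs3 : 0 < s ^ 3 := by positivity
    rcases abs_cases K with ⟨h, _⟩ | ⟨h, _⟩ <;> rw [h]
    · apply le_of_mul_le_mul_right _ hs3
      nlinarith
    · apply le_of_mul_le_mul_right _ hs3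
      nlinarith
  have hK0 : K = 0 := by
    by_contra hne
    have hKp : 0 < |K| := abs_pos.2 hne
    have := hKabs (min (r / 2) (|K| / 3 / (B + 1) / 2)) (by positivity)
      ((min_le_left _ _).trans_lt (by linarith))
    have h1 : B * min (r / 2) (|K| / 3 / (B + 1) / 2) ≤ B * (|K| / 3 / (B + 1) / 2) := by
      gcongr; exact min_le_right _ _
    have h2 : B * (|K| / 3 / (B + 1)) ≤ |K| / 3 := by
      rw [← mul_div_assoc, div_le_iff₀ (by positivity)]
      nlinarith
    linarith
  -- contradiction
  have hfin : ∀ s : ℝ, 0 < s → s < r → s ≤ ε → δ ≤ B * √s := by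
    intro s hs hsr hsε
    obtain ⟨i1, -⟩ := hball (x := s) (by simpa [abs_of_pos hs] using hsr)
    have i2 := hbar s hs.le hsε
    have e : (0 : ℝ × ℝ) + s • ((0, 1) : ℝ × ℝ) = (0, s) := by simp
    rw [e, hK0, abs_of_pos hs] at i1
    have i3 := (abs_le.1 i1).1
    have h1 : √s * √s = s := Real.mul_self_sqrt hs.le
    have h2 : 0 < √s * s ^ 3 := mul_pos (Real.sqrt_pos.2 hs) (by positivity)
    apply le_of_mul_le_mul_right _ h2
    have : B * √s * (√s * s ^ 3) = B * s ^ 4 := by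
      calc B * √s * (√s * s ^ 3) = B * (√s * √s) * s ^ 3 := by ring
        _ = B * s ^ 4 := by rw [h1]; ring
    rw [this]
    linarith
  have hlim : Tendsto (fun s : ℝ => B * √s) (nhdsWithin 0 (Ioi 0)) (nhds 0) := by
    have : Continuous (fun s : ℝ => B * √s) := by fun_prop
    have := (this.tendsto 0).mono_left (nhdsWithin_le_nhds (s := Ioi 0))
    simpa using this
  have m : ∀ᶠ s in nhdsWithin (0 : ℝ) (Ioi 0), s ∈ Ioo (0 : ℝ) (min r ε) :=
    Ioo_mem_nhdsGT (lt_min hr hε)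
  obtain ⟨s, h1, h2'⟩ := ((hlim.eventually_lt_const hδ).and m).exists
  have := hfin s h2'.1 (h2'.2.trans_le (min_le_left _ _)) (h2'.2.le.trans (min_le_right _ _))
  linarith

end core

section final

variable {W V : Set (ℝ × ℝ)} {U ux uy uxx uxy uyy uxxx uxxy uxyy uyyy : ℝ × ℝ → ℝ}
  {f : ℝ → ℝ} {F : ℝ → ℝ → ℝ}

/-- Data transported by a rotation. -/
lemma Dat.rotate (D : Dat W U ux uy uxx uxy uyy uxxx uxxy uxyy uyyy) (a b : ℝ) (T : ℝ × ℝ → ℝ × ℝ)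
    (hT : T = fun z => (a * z.1 - b * z.2, b * z.1 + a * z.2)) :
    Dat (T ⁻¹' W) (fun z => U (T z)) (fun z => a * ux (T z) + b * uy (T z))
      (fun z => -b * ux (T z) + a * uy (T z))
      (fun z => a ^ 2 * uxx (T z) + 2 * a * b * uxy (T z) + b ^ 2 * uyy (T z))
      (fun z => -(a * b) * uxx (T z) + (a ^ 2 - b ^ 2) * uxy (T z) + a * b * uyy (T z))
      (fun z => b ^ 2 * uxx (T z) + -(2 * a * b) * uxy (T z) + a ^ 2 * uyy (T z))
      (fun z => a ^ 3 * uxxx (T z) + 3 * a ^ 2 * b * uxxy (T z) + 3 * a * b ^ 2 * uxyy (T z)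
        + b ^ 3 * uyyy (T z))
      (fun z => -(a ^ 2 * b) * uxxx (T z) + (a ^ 3 - 2 * a * b ^ 2) * uxxy (T z)
        + (2 * a ^ 2 * b - b ^ 3) * uxyy (T z) + a * b ^ 2 * uyyy (T z))
      (fun z => a * b ^ 2 * uxxx (T z) + (b ^ 3 - 2 * a ^ 2 * b) * uxxy (T z)
        + (a ^ 3 - 2 * a * b ^ 2) * uxyy (T z) + a ^ 2 * b * uyyy (T z))
      (fun z => -b ^ 3 * uxxx (T z) + 3 * a * b ^ 2 * uxxy (T z) - 3 * a ^ 2 * b * uxyy (T z)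
        + a ^ 3 * uyyy (T z)) := by
  have hc : Continuous T := by rw [hT]; fun_prop
  have rot : ∀ {F Fx Fy : ℝ × ℝ → ℝ}, (∀ p ∈ W, HasGrad F (Fx p) (Fy p) p) →
      ∀ p ∈ T ⁻¹' W, HasGrad (fun z => F (T z)) (a * Fx (T p) + b * Fy (T p))
        (-b * Fx (T p) + a * Fy (T p)) p := by
    intro F Fx Fy h p hp
    have := h (T p) hp
    rw [hT] at this ⊢
    exact this.rot a b
  refine ⟨D.opn.preimage hc, rot D.hU, fun p hp => ?_, fun p hp => ?_, fun p hp => ?_,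
    fun p hp => ?_, fun p hp => ?_⟩
  · exact (((rot D.hux p hp).const_mul a).add ((rot D.huy p hp).const_mul b)).congr
      (by ring) (by ring)
  · exact (((rot D.hux p hp).const_mul (-b)).add ((rot D.huy p hp).const_mul a)).congr
      (by ring) (by ring)
  · exact ((((rot D.huxx p hp).const_mul (a ^ 2)).add ((rot D.huxy p hp).const_mul (2 * a * b))).add
      ((rot D.huyy p hp).const_mul (b ^ 2))).congr (by ring) (by ring)
  · exact ((((rot D.huxx p hp).const_mul (-(a * b))).add
      ((rot D.huxy p hp).const_mul (a ^ 2 - b ^ 2))).add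
      ((rot D.huyy p hp).const_mul (a * b))).congr (by ring) (by ring)
  · exact ((((rot D.huxx p hp).const_mul (b ^ 2)).add
      ((rot D.huxy p hp).const_mul (-(2 * a * b)))).add
      ((rot D.huyy p hp).const_mul (a ^ 2))).congr (by ring) (by ring)

/-- A singular symmetric 2 by 2 matrix has a unit kernel vector. -/
lemma exists_kernel (p q r : ℝ) (h : p * r - q ^ 2 = 0) :
    ∃ a b : ℝ, a ^ 2 + b ^ 2 = 1 ∧ p * a + q * b = 0 ∧ q * a + r * b = 0 := by
  have key : ∀ v w : ℝ, v ^ 2 + w ^ 2 ≠ 0 → p * v + q * w = 0 → q * v + r * w = 0 →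
      ∃ a b : ℝ, a ^ 2 + b ^ 2 = 1 ∧ p * a + q * b = 0 ∧ q * a + r * b = 0 := by
    intro v w hvw h1 h2
    have hn : 0 < v ^ 2 + w ^ 2 := lt_of_le_of_ne (by positivity) hvw.symm
    have hs : √(v ^ 2 + w ^ 2) ^ 2 = v ^ 2 + w ^ 2 := Real.sq_sqrt hn.le
    have hs0 : 0 < √(v ^ 2 + w ^ 2) := Real.sqrt_pos.2 hn
    refine ⟨v / √(v ^ 2 + w ^ 2), w / √(v ^ 2 + w ^ 2), ?_, ?_, ?_⟩
    · rw [div_pow, div_pow, hs, ← add_div, div_self hvw]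
    · rw [← mul_div_assoc, ← mul_div_assoc, ← add_div, h1, zero_div]
    · rw [← mul_div_assoc, ← mul_div_assoc, ← add_div, h2, zero_div]
  by_cases hpq : p ^ 2 + q ^ 2 = 0
  · have hp : p = 0 := by nlinarith [sq_nonneg p, sq_nonneg q]
    have hq : q = 0 := by nlinarith [sq_nonneg p, sq_nonneg q]
    exact ⟨1, 0, by norm_num, by rw [hp, hq]; ring, by rw [hq]; ring⟩
  · refine key (-q) p (by rw [neg_sq, add_comm]; exact hpq) (by ring) (by linarith)

/-- The theorem for abstract derivative data. -/
lemma core_rot (D : Dat W U ux uy uxx uxy uyy uxxx uxxy uxyy uyyy)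
    (hf : Differentiable ℝ f)
    (hpde : ∀ p ∈ W, -(uxx p + uyy p) = f (U p))
    (h0 : (0 : ℝ × ℝ) ∈ W) (hx0 : ux 0 = 0) (hy0 : uy 0 = 0)
    (hdet : uxx 0 * uyy 0 - uxy 0 ^ 2 = 0)
    (hd1 : DifferentiableAt ℝ uxxx 0) (hd2 : DifferentiableAt ℝ uxxy 0)
    (hd3 : DifferentiableAt ℝ uxyy 0) (hd4 : DifferentiableAt ℝ uyyy 0)
    (huniq : ∀ p ∈ W, ux p = 0 → uy p = 0 → p = 0) (c : ℝ) (hc : c < U 0)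
    (hcomp : IsCompact {p | p ∈ W ∧ c ≤ U p})
    (hcurv : ∀ p ∈ W, U p = c →
      uxx p * uy p ^ 2 - 2 * uxy p * ux p * uy p + uyy p * ux p ^ 2 < 0) : False := by
  obtain ⟨a, b, hab, k1, k2⟩ := exists_kernel _ _ _ hdet
  obtain ⟨T, hT⟩ : ∃ T : ℝ × ℝ → ℝ × ℝ, T = fun z => (a * z.1 - b * z.2, b * z.1 + a * z.2) :=
    ⟨_, rfl⟩
  have hT0 : T 0 = 0 := by rw [hT]; simp
  obtain ⟨S, hS⟩ : ∃ S : ℝ × ℝ → ℝ × ℝ, S = fun z => (a * z.1 + b * z.2, -b * z.1 + a * z.2) :=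
    ⟨_, rfl⟩
  have hScont : Continuous S := by rw [hS]; fun_prop
  have hTd : Differentiable ℝ T := by rw [hT]; fun_prop
  have hST : ∀ z, S (T z) = z := by
    intro z
    rw [hS, hT]
    ext
    · show a * (a * z.1 - b * z.2) + b * (b * z.1 + a * z.2) = z.1
      linear_combination z.1 * hab
    · show -b * (a * z.1 - b * z.2) + a * (b * z.1 + a * z.2) = z.2
      linear_combination z.2 * hab
  have hTS : ∀ z, T (S z) = z := by
    intro z
    rw [hS, hT]
    ext
    · show a * (a * z.1 + b * z.2) - b * (-b * z.1 + a * z.2) = z.1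
      linear_combination z.1 * hab
    · show b * (a * z.1 + b * z.2) + a * (-b * z.1 + a * z.2) = z.2
      linear_combination z.2 * hab
  have hcd : ∀ H : ℝ × ℝ → ℝ, DifferentiableAt ℝ H 0 → DifferentiableAt ℝ (fun z => H (T z)) 0 := by
    intro H hH
    rw [← hT0] at hH
    exact hH.comp (0 : ℝ × ℝ) (hTd 0)
  refine core_thm (D.rotate a b T hT) hf ?_ ?_ ?_ ?_ ?_ ?_ ?_ ?_ c ?_ ?_ ?_
  · intro p hp
    rw [← hpde (T p) hp]
    linear_combination (-(uxx (T p)) - uyy (T p)) * hab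
  · show T 0 ∈ W
    rw [hT0]; exact h0
  · simp [hT0, hx0, hy0]
  · simp [hT0, hx0, hy0]
  · simp only [hT0]
    linear_combination a * k1 + b * k2
  · simp only [hT0]
    linear_combination -b * k1 + a * k2
  · have e1 := hcd _ hd1
    have e2 := hcd _ hd2
    have e3 := hcd _ hd3
    have e4 := hcd _ hd4
    exact (((e1.const_mul _).add (e2.const_mul _)).add (e3.const_mul _)).add (e4.const_mul _)
  · intro p hp h1 h2
    have i1 : ux (T p) = 0 := by linear_combination a * h1 - b * h2 - ux (T p) * hab
    have i2 : uy (T p) = 0 := by linear_combination b * h1 + a * h2 - uy (T p) * hab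
    have := huniq _ hp i1 i2
    calc p = S (T p) := (hST p).symm
      _ = S (T 0) := by rw [this, hT0]
      _ = 0 := hST 0
  · simpa [hT0] using hc
  · have := hcomp.image hScont
    convert this using 1
    ext p
    constructor
    · rintro ⟨h1, h2⟩
      exact ⟨T p, ⟨h1, h2⟩, hST p⟩
    · rintro ⟨q, ⟨h1, h2⟩, rfl⟩
      refine ⟨?_, ?_⟩
      · show T (S q) ∈ W
        rw [hTS]; exact h1
      · show c ≤ U (T (S q))
        rw [hTS]; exact h2
  · intro p hp hUp
    have := hcurv (T p) hp hUp
    refine lt_of_eq_of_lt ?_ this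
    generalize uxx (T p) = A
    generalize uxy (T p) = B
    generalize uyy (T p) = C
    generalize ux (T p) = x
    generalize uy (T p) = y
    linear_combination ((A * y ^ 2 - 2 * B * x * y + C * x ^ 2) * (a ^ 2 + b ^ 2 + 1)) * hab

/-- Smoothness of a function of two variables on a set. -/
def Smo (V : Set (ℝ × ℝ)) (F : ℝ → ℝ → ℝ) : Prop :=
  ContDiffOn ℝ (⊤ : ℕ∞) (fun p : ℝ × ℝ => F p.1 p.2) V

lemma Smo.diffAt (hV : IsOpen V) (h : Smo V F) {p : ℝ × ℝ} (hp : p ∈ V) :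
    DifferentiableAt ℝ (fun p : ℝ × ℝ => F p.1 p.2) p :=
  (ContDiffOn.contDiffAt h (hV.mem_nhds hp)).differentiableAt (by simp)

lemma Smo.pdx_eq (hV : IsOpen V) (h : Smo V F) {p : ℝ × ℝ} (hp : p ∈ V) :
    pdx F p.1 p.2 = fderiv ℝ (fun p : ℝ × ℝ => F p.1 p.2) p (1, 0) := by
  have h1 : HasDerivAt (fun t : ℝ => ((t, p.2) : ℝ × ℝ)) (1, 0) p.1 :=
    (hasDerivAt_id p.1).prodMk (hasDerivAt_const _ _)
  exact (HasFDerivAt.comp_hasDerivAt (f := fun t : ℝ => ((t, p.2) : ℝ × ℝ)) p.1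
    (h.diffAt hV hp).hasFDerivAt h1).deriv

lemma Smo.pdy_eq (hV : IsOpen V) (h : Smo V F) {p : ℝ × ℝ} (hp : p ∈ V) :
    pdy F p.1 p.2 = fderiv ℝ (fun p : ℝ × ℝ => F p.1 p.2) p (0, 1) := by
  have h1 : HasDerivAt (fun t : ℝ => ((p.1, t) : ℝ × ℝ)) (0, 1) p.2 :=
    (hasDerivAt_const _ _).prodMk (hasDerivAt_id p.2)
  exact (HasFDerivAt.comp_hasDerivAt (f := fun t : ℝ => ((p.1, t) : ℝ × ℝ)) p.2
    (h.diffAt hV hp).hasFDerivAt h1).deriv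

lemma Smo.grad (hV : IsOpen V) (h : Smo V F) {p : ℝ × ℝ} (hp : p ∈ V) :
    HasGrad (fun p => F p.1 p.2) (pdx F p.1 p.2) (pdy F p.1 p.2) p := by
  refine HasFDerivAt.congr_fderiv (h.diffAt hV hp).hasFDerivAt ?_
  rw [h.pdx_eq hV hp, h.pdy_eq hV hp]
  ext <;> simp

lemma Smo.fd (hV : IsOpen V) (h : Smo V F) :
    ContDiffOn ℝ (⊤ : ℕ∞) (fderiv ℝ (fun p : ℝ × ℝ => F p.1 p.2)) V :=
  ContDiffOn.fderiv_of_isOpen h hV (by simp)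

lemma Smo.dx (hV : IsOpen V) (h : Smo V F) : Smo V (pdx F) :=
  ((h.fd hV).clm_apply contDiffOn_const).congr fun _ hp => h.pdx_eq hV hp

lemma Smo.dy (hV : IsOpen V) (h : Smo V F) : Smo V (pdy F) :=
  ((h.fd hV).clm_apply contDiffOn_const).congr fun _ hp => h.pdy_eq hV hp

lemma Smo.comm (hV : IsOpen V) (h : Smo V F) {p : ℝ × ℝ} (hp : p ∈ V) :
    pdy (pdx F) p.1 p.2 = pdx (pdy F) p.1 p.2 := by
  have hs : IsSymmSndFDerivAt ℝ (fun p : ℝ × ℝ => F p.1 p.2) p :=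
    (ContDiffOn.contDiffAt h (hV.mem_nhds hp)).isSymmSndFDerivAt (by
      rw [minSmoothness_of_isRCLikeNormedField]
      exact WithTop.coe_le_coe.2 le_top)
  have hd : DifferentiableAt ℝ (fderiv ℝ (fun p : ℝ × ℝ => F p.1 p.2)) p :=
    ((h.fd hV).contDiffAt (hV.mem_nhds hp)).differentiableAt (by simp)
  rw [(h.dx hV).pdy_eq hV hp, (h.dy hV).pdx_eq hV hp]
  have e1 : (fun p : ℝ × ℝ => pdx F p.1 p.2) =ᶠ[nhds p]
      fun p => fderiv ℝ (fun p : ℝ × ℝ => F p.1 p.2) p (1, 0) := by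
    filter_upwards [hV.mem_nhds hp] with q hq using h.pdx_eq hV hq
  have e2 : (fun p : ℝ × ℝ => pdy F p.1 p.2) =ᶠ[nhds p]
      fun p => fderiv ℝ (fun p : ℝ × ℝ => F p.1 p.2) p (0, 1) := by
    filter_upwards [hV.mem_nhds hp] with q hq using h.pdy_eq hV hq
  rw [e1.fderiv_eq, e2.fderiv_eq, fderiv_clm_apply hd (by fun_prop),
    fderiv_clm_apply hd (by fun_prop)]
  simpa using (hs (0, 1) (1, 0))

lemma Smo.dat (hV : IsOpen V) (h : Smo V F) (hW : IsOpen W) (hWV : W ⊆ V) :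
    Dat W (fun p => F p.1 p.2) (fun p => pd F 1 0 p.1 p.2) (fun p => pd F 0 1 p.1 p.2)
      (fun p => pd F 2 0 p.1 p.2) (fun p => pd F 1 1 p.1 p.2) (fun p => pd F 0 2 p.1 p.2)
      (fun p => pd F 3 0 p.1 p.2) (fun p => pd F 2 1 p.1 p.2) (fun p => pd F 1 2 p.1 p.2)
      (fun p => pd F 0 3 p.1 p.2) := by
  have hx := h.dx hV
  have hy := h.dy hV
  have hxx := hx.dx hV
  have hxy := hy.dx hV
  have hyy := hy.dy hV
  refine ⟨hW, fun p hp => ?_, fun p hp => ?_, fun p hp => ?_, fun p hp => ?_,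
    fun p hp => ?_, fun p hp => ?_⟩
  · exact h.grad hV (hWV hp)
  · exact (hx.grad hV (hWV hp)).congr rfl (h.comm hV (hWV hp))
  · exact hy.grad hV (hWV hp)
  · refine (hxx.grad hV (hWV hp)).congr rfl ?_
    rw [hx.comm hV (hWV hp)]
    have e : (fun t => pdy (pdx F) t p.2) =ᶠ[nhds p.1] fun t => pdx (pdy F) t p.2 := by
      have hc : Continuous (fun t : ℝ => ((t, p.2) : ℝ × ℝ)) := by fun_prop
      filter_upwards [hc.continuousAt.preimage_mem_nhds (hV.mem_nhds (hWV hp))] with t ht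
      exact h.comm hV ht
    exact e.deriv_eq
  · exact (hxy.grad hV (hWV hp)).congr rfl (hy.comm hV (hWV hp))
  · exact hyy.grad hV (hWV hp)

end final

/-- either the unique critical point `(0,0)` is nondegenerate, or
every level set of `u` contains a point of nonpositive curvature. -/
theorem nondegenerate_or_nonconvex_levels
    (Ω : Set (ℝ × ℝ)) (hopen : IsOpen Ω) (hconn : IsConnected Ω)
    (hbdd : Bornology.IsBounded Ω) (h0 : ((0, 0) : ℝ × ℝ) ∈ Ω)
    (u : ℝ → ℝ → ℝ) (f : ℝ → ℝ)
    (V : Set (ℝ × ℝ)) (hV : IsOpen V) (hΩV : closure Ω ⊆ V)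
    (hu : ContDiffOn ℝ (⊤ : ℕ∞) (fun p : ℝ × ℝ => u p.1 p.2) V)
    (hf : ContDiff ℝ (⊤ : ℕ∞) f) (hf0 : 0 ≤ f 0)
    (hpde : ∀ p ∈ Ω, -(pd u 2 0 p.1 p.2 + pd u 0 2 p.1 p.2) = f (u p.1 p.2))
    (hpos : ∀ p ∈ Ω, 0 < u p.1 p.2)
    (hbc : ∀ p ∈ frontier Ω, u p.1 p.2 = 0)
    (hcrit0 : pd u 1 0 0 0 = 0 ∧ pd u 0 1 0 0 = 0)
    (huniq : ∀ p ∈ Ω, pd u 1 0 p.1 p.2 = 0 → pd u 0 1 p.1 p.2 = 0 → p = ((0, 0) : ℝ × ℝ)) :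
    pd u 2 0 0 0 * pd u 0 2 0 0 - (pd u 1 1 0 0) ^ 2 ≠ 0 ∨
    ∀ c : ℝ, 0 < c → c < u 0 0 →
      ∃ p ∈ Ω, u p.1 p.2 = c ∧ 0 ≤ curvNum u p.1 p.2 := by
  by_contra hcon
  push Not at hcon
  obtain ⟨hdet, c, hc0, hcu, hcurv⟩ := hcon
  have hs : Smo V u := hu
  have hΩV' : Ω ⊆ V := subset_closure.trans hΩV
  have h0V : (0 : ℝ × ℝ) ∈ V := hΩV' h0
  have hx := hs.dx hV
  have hy := hs.dy hV
  have hxx := hx.dx hV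
  have hxy := hy.dx hV
  have hyy := hy.dy hV
  refine core_rot (hs.dat hV hopen hΩV') (hf.differentiable (by simp)) hpde h0 hcrit0.1 hcrit0.2
    hdet ((hxx.dx hV).diffAt hV h0V) ((hxy.dx hV).diffAt hV h0V) ((hyy.dx hV).diffAt hV h0V)
    ((hyy.dy hV).diffAt hV h0V) huniq c hcu ?_ hcurv
  have hcl : IsCompact (closure Ω) := hbdd.isCompact_closure
  have hco : ContinuousOn (fun p : ℝ × ℝ => u p.1 p.2) (closure Ω) :=
    hu.continuousOn.mono hΩV
  have : IsClosed (closure Ω ∩ (fun p : ℝ × ℝ => u p.1 p.2) ⁻¹' Ici c) :=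
    hco.preimage_isClosed_of_isClosed isClosed_closure isClosed_Ici
  convert hcl.of_isClosed_subset this inter_subset_left using 1
  ext p
  constructor
  · rintro ⟨h1, h2⟩
    exact ⟨subset_closure h1, h2⟩
  · rintro ⟨h1, h2⟩
    have h2' : c ≤ u p.1 p.2 := h2
    refine ⟨?_, h2⟩
    by_contra hp
    have hfr : p ∈ frontier Ω := by
      rw [hopen.frontier_eq]; exact ⟨h1, hp⟩
    have := hbc p hfr
    linarith
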